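/- Let (W,S) be the Coxeter system of type E_6: S = {1,...,6} with m(1,3) = m(3,4) = m(4,5) = m(5,6) = m(2,4) = 3 and all other pairs commuting (m = 2). Then the homology of the weighted complex C_*(W) is: H_0 ≅ R/(Φ_2); H_1 = H_2 = H_3 = 0; H_4 ≅ R/(Φ_6) ⊕ R/(Φ_8); H_5 ≅ R/(Φ_3) ⊕ R/(Φ_6) ⊕ R/(Φ_9) ⊕ R/(Φ_12); and H_k = 0 for all k ≥ 6. -/

import Mathlib

open Polynomial CoxeterSystem

set_option synthInstance.maxHeartbeats 1000000
set_option maxHeartbeats 1000000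

noncomputable section

/-- The ring `R = ℚ[q,q⁻¹]` of Laurent polynomials over `ℚ`. -/
abbrev R : Type := LaurentPolynomial ℚ

/-- The image of the `d`-th cyclotomic polynomial `Φ_d` in `R`. -/
def cyc (d : ℕ) : R := Polynomial.toLaurent (Polynomial.cyclotomic d ℚ)

/-- The `R`-module `R/(Φ_d)`. -/
abbrev CycQuot (d : ℕ) := R ⧸ Ideal.span {cyc d}

variable {B : Type*} [Fintype B] [LinearOrder B] {W : Type*} [Group W]
  {M : CoxeterMatrix B} (cs : CoxeterSystem M W)

/-- The standard parabolic subgroup `W_σ` generated by `σ ⊆ S`. -/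
def parabolic (σ : Finset B) : Subgroup W := Subgroup.closure (cs.simple '' σ)

/-- The Poincaré polynomial `W_σ(q) = Σ_{w ∈ W_σ} q^{ℓ(w)}` of the standard parabolic
subgroup `W_σ` (defined to be `0` if `W_σ` is infinite). -/
def poin (σ : Finset B) : ℚ[X] :=
  letI := Classical.dec ((parabolic cs σ : Set W).Finite)
  if h : (parabolic cs σ : Set W).Finite then ∑ w ∈ h.toFinset, X ^ cs.length w else 0

/-- The set of simplices `σ ∈ K_W` with `|σ| = k`, i.e. the subsets of `S` of
cardinality `k` generating a finite standard parabolic subgroup. -/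
abbrev KW (k : ℕ) := {σ : Finset B // σ.card = k ∧ (parabolic cs σ : Set W).Finite}

noncomputable instance (k : ℕ) : Fintype (KW cs k) := Fintype.ofFinite _

/-- The coefficient of `e_τ` in `∂ e_σ`: it is
`(−1)^{#{t ∈ σ : t < s}} · W_σ(q)/W_{σ∖{s}}(q)` if `τ = σ ∖ {s}` for some `s ∈ σ`,
and `0` otherwise. -/
def bcoeff (σ τ : Finset B) : R :=
  ∑ s ∈ σ, if τ = σ.erase s then
      (-1 : R) ^ (σ.filter (fun t => t < s)).card *
        Polynomial.toLaurent (poin cs σ / poin cs τ)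
    else 0

/-- The boundary map `∂ : C_{k+1} → C_k` of the weighted complex `C_*(W)`, where
`C_k = ⊕_{σ ∈ K_W, |σ| = k} R·e_σ`. -/
def bdry (k : ℕ) : (KW cs (k + 1) → R) →ₗ[R] (KW cs k → R) :=
  Matrix.mulVecLin (Matrix.of fun (τ : KW cs k) (σ : KW cs (k + 1)) => bcoeff cs σ.1 τ.1)

/-- The submodule of cycles in degree `k` of the weighted complex. -/
def cycles : (k : ℕ) → Submodule R (KW cs k → R)
  | 0 => ⊤
  | (k + 1) => LinearMap.ker (bdry cs k)

/-- The `k`-th homology `H_k(C_*(W))` of the weighted complex: cycles modulo boundaries. -/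
abbrev Hgy (k : ℕ) :=
  cycles cs k ⧸ Submodule.comap (cycles cs k).subtype (LinearMap.range (bdry cs k))

end

namespace WeightedComplex

/-! ### Quotients of `R` by products of cyclotomic polynomials -/

lemma nonempty_quotient_mul_equiv_prod {A : Type*} [CommRing A] {a b : A} (h : IsCoprime a b) :
    Nonempty ((A ⧸ Ideal.span {a * b}) ≃ₗ[A] (A ⧸ Ideal.span {a}) × (A ⧸ Ideal.span {b})) := by
  let f : A →ₗ[A] (A ⧸ Ideal.span {a}) × (A ⧸ Ideal.span {b}) :=
    (Submodule.mkQ (Ideal.span {a})).prod (Submodule.mkQ (Ideal.span {b}))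
  have hker : LinearMap.ker f = Ideal.span {a * b} := by
    ext x
    simp only [f, LinearMap.ker_prod, Submodule.ker_mkQ, Submodule.mem_inf,
      Ideal.mem_span_singleton]
    exact ⟨fun hx => h.mul_dvd hx.1 hx.2, fun hx => ⟨(dvd_mul_right a b).trans hx,
      (dvd_mul_left b a).trans hx⟩⟩
  have hsurj : Function.Surjective f := by
    rintro ⟨x, y⟩
    obtain ⟨x, rfl⟩ := Submodule.mkQ_surjective _ x
    obtain ⟨y, rfl⟩ := Submodule.mkQ_surjective _ y
    obtain ⟨u, v, huv⟩ := h
    refine ⟨y * (u * a) + x * (v * b), Prod.ext ?_ ?_⟩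
    · refine (Submodule.Quotient.eq _).2 (Ideal.mem_span_singleton.2 ⟨(y - x) * u, ?_⟩)
      linear_combination x * huv
    · refine (Submodule.Quotient.eq _).2 (Ideal.mem_span_singleton.2 ⟨(x - y) * v, ?_⟩)
      linear_combination y * huv
  exact ⟨(Submodule.quotEquivOfEq _ _ hker.symm).trans (f.quotKerEquivOfSurjective hsurj)⟩

lemma isCoprime_cyc {m n : ℕ} (h : m ≠ n) : IsCoprime (cyc m) (cyc n) :=
  (Polynomial.cyclotomic.isCoprime_rat h).map (Polynomial.toLaurent (R := ℚ))

/-! ### Computing homology from matrix identities -/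

section Certificate

variable {A : Type*} [CommRing A] {α β γ δ : Type*}
  [Fintype α] [Fintype β] [Fintype γ] [Fintype δ]

open Matrix

/-- Homology of a three-term sequence of free modules: cycles modulo boundaries. -/
abbrev SeqHomology (M : Matrix β α A) (Z : Submodule A (β → A)) :=
  Z ⧸ Submodule.comap Z.subtype (LinearMap.range M.mulVecLin)

lemma mulVec_eq_zero_of_smul_eq_mul [IsDomain A] {N : Matrix β β A} {Q : Matrix β γ A}
    {B : Matrix γ β A} {d : A} (hd : d ≠ 0) (h : d • N = Q * B) {x : β → A} (hx : B *ᵥ x = 0) :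
    N *ᵥ x = 0 := by
  have h1 : d • N *ᵥ x = 0 := by
    rw [← Matrix.smul_mulVec, h, ← Matrix.mulVec_mulVec, hx, Matrix.mulVec_zero]
  exact (smul_eq_zero.1 h1).resolve_left hd

variable [DecidableEq β] [DecidableEq δ]

lemma subsingleton_seqHomology {M : Matrix β α A} {H : Matrix α β A}
    {Z : Submodule A (β → A)} {u : A} (hu : IsUnit u)
    (h : ∀ x ∈ Z, (u • (1 : Matrix β β A) - M * H) *ᵥ x = 0) :
    Subsingleton (SeqHomology M Z) := by
  rw [Submodule.Quotient.subsingleton_iff, eq_top_iff]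
  rintro ⟨x, hx⟩ -
  obtain ⟨v, rfl⟩ := hu
  have h1 := h x hx
  rw [Matrix.sub_mulVec, Matrix.smul_mulVec, Matrix.one_mulVec, ← Matrix.mulVec_mulVec,
    sub_eq_zero] at h1
  refine ⟨((v⁻¹ : Aˣ) : A) • (H *ᵥ x), ?_⟩
  rw [map_smul, Matrix.mulVecLin_apply, ← h1, smul_smul]
  simp

lemma nonempty_seqHomology_equiv {M : Matrix β α A} {H : Matrix α β A}
    {z : Matrix β δ A} {φ : Matrix δ β A} {y : Matrix α δ A} {ψ : Matrix δ α A}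
    {Z : Submodule A (β → A)} {u p : A} [Unique δ] (hu : IsUnit u)
    (h : ∀ x ∈ Z, (u • (1 : Matrix β β A) - z * φ - M * H) *ᵥ x = 0)
    (hz : ∀ c, z *ᵥ c ∈ Z) (hφz : φ * z = u • 1)
    (hy : M * y = (u * p) • z) (hψ : φ * M = p • ψ) :
    Nonempty (SeqHomology M Z ≃ₗ[A] A ⧸ Ideal.span {p}) := by
  obtain ⟨v, rfl⟩ := hu
  let f : Z →ₗ[A] A ⧸ Ideal.span {p} :=
    (Submodule.mkQ (Ideal.span {p})) ∘ₗ (LinearMap.proj default) ∘ₗ φ.mulVecLin ∘ₗ Z.subtype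
  have hf : ∀ x : Z, f x = Submodule.Quotient.mk ((φ *ᵥ x.1) default) := fun x => rfl
  have hker : LinearMap.ker f = Submodule.comap Z.subtype (LinearMap.range M.mulVecLin) := by
    ext ⟨x, hx⟩
    rw [LinearMap.mem_ker, hf, Submodule.Quotient.mk_eq_zero, Ideal.mem_span_singleton,
      Submodule.mem_comap]
    constructor
    · rintro ⟨c, hc⟩
      have hc' : φ *ᵥ x = p • fun _ => c := by
        funext i
        rw [Subsingleton.elim i default]
        exact hc
      have h1 := h x hx
      rw [Matrix.sub_mulVec, Matrix.sub_mulVec, Matrix.smul_mulVec, Matrix.one_mulVec,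
        ← Matrix.mulVec_mulVec, ← Matrix.mulVec_mulVec, sub_sub, sub_eq_zero] at h1
      have h2 : (v : A) • z *ᵥ (φ *ᵥ x) = M *ᵥ (y *ᵥ fun _ => c) := by
        rw [hc', Matrix.mulVec_smul, smul_smul, ← Matrix.smul_mulVec, ← hy, Matrix.mulVec_mulVec]
      refine ⟨((v⁻¹ : Aˣ) : A) • (H *ᵥ x) +
        ((v⁻¹ : Aˣ) : A) • ((v⁻¹ : Aˣ) : A) • (y *ᵥ fun _ => c), ?_⟩
      rw [map_add, map_smul, map_smul, map_smul, Matrix.mulVecLin_apply, Matrix.mulVecLin_apply,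
        ← h2, smul_smul _ (v : A), Units.inv_mul, one_smul, ← smul_add, add_comm, ← h1, smul_smul,
        Units.inv_mul, one_smul]
      rfl
    · rintro ⟨w, hw⟩
      refine ⟨(ψ *ᵥ w) default, ?_⟩
      change M *ᵥ w = x at hw
      change (φ *ᵥ x) default = _
      rw [← hw, Matrix.mulVec_mulVec, hψ, Matrix.smul_mulVec]
      rfl
  have hsurj : Function.Surjective f := by
    intro c
    obtain ⟨c, rfl⟩ := Submodule.mkQ_surjective _ c
    refine ⟨⟨z *ᵥ fun _ => ((v⁻¹ : Aˣ) : A) * c, hz _⟩, ?_⟩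
    rw [hf, Matrix.mulVec_mulVec, hφz, Matrix.smul_mulVec, Matrix.one_mulVec]
    simp
  exact ⟨(Submodule.quotEquivOfEq _ _ hker.symm).trans (f.quotKerEquivOfSurjective hsurj)⟩

end Certificate

/-! ### Computable integer polynomials and matrices of polynomials -/

/-- The polynomial with the given list of coefficients, lowest degree first. -/
noncomputable def toPoly : List ℤ → ℚ[X]
  | [] => 0
  | a :: l => Polynomial.C (a : ℚ) + X * toPoly l

/-- Sum of coefficient lists. -/
def addL : List ℤ → List ℤ → List ℤ
  | [], l => l
  | a :: l, [] => a :: l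
  | a :: l, b :: l' => (a + b) :: addL l l'

/-- Scalar multiple of a coefficient list. -/
def smulL (c : ℤ) (l : List ℤ) : List ℤ := l.map (c * ·)

/-- Product of coefficient lists. -/
def mulL : List ℤ → List ℤ → List ℤ
  | [], _ => []
  | a :: l, l' => addL (smulL a l') (0 :: mulL l l')

/-- Equality of coefficient lists up to trailing zeros. -/
def eqL (l l' : List ℤ) : Bool := (addL l (smulL (-1) l')).all (· == 0)

@[simp] lemma toPoly_nil : toPoly [] = 0 := rfl

lemma toPoly_cons (a : ℤ) (l : List ℤ) :
    toPoly (a :: l) = Polynomial.C (a : ℚ) + X * toPoly l := rfl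

lemma toPoly_addL (l l' : List ℤ) : toPoly (addL l l') = toPoly l + toPoly l' := by
  induction l generalizing l' with
  | nil => simp [addL]
  | cons a l ih =>
    cases l' with
    | nil => simp [addL]
    | cons b l' =>
      simp only [addL, toPoly_cons, ih, Int.cast_add, map_add]
      ring

lemma toPoly_smulL (c : ℤ) (l : List ℤ) :
    toPoly (smulL c l) = Polynomial.C (c : ℚ) * toPoly l := by
  induction l with
  | nil => simp [smulL]
  | cons a l ih =>
    simp only [smulL, List.map_cons, toPoly_cons, Int.cast_mul, map_mul] at ih ⊢
    rw [ih]
    ring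

lemma toPoly_mulL (l l' : List ℤ) : toPoly (mulL l l') = toPoly l * toPoly l' := by
  induction l with
  | nil => simp [mulL]
  | cons a l ih =>
    simp only [mulL, toPoly_addL, toPoly_smulL, toPoly_cons, ih, Int.cast_zero, map_zero]
    ring

lemma toPoly_eq_zero {l : List ℤ} (h : l.all (· == 0)) : toPoly l = 0 := by
  induction l with
  | nil => rfl
  | cons a l ih =>
    simp only [List.all_cons, Bool.and_eq_true, beq_iff_eq] at h
    simp [toPoly_cons, h.1, ih h.2]

lemma toPoly_eq_of_eqL {l l' : List ℤ} (h : eqL l l') : toPoly l = toPoly l' := by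
  have := toPoly_eq_zero h
  rw [toPoly_addL, toPoly_smulL] at this
  simp only [Int.cast_neg, Int.cast_one, map_neg, map_one] at this
  linear_combination this

lemma toPoly_ne_zero {l : List ℤ} {a : ℤ} (ha : a ≠ 0) : toPoly (a :: l) ≠ 0 := by
  intro h
  have := congrArg (Polynomial.eval 0) h
  simp [toPoly_cons, ha] at this

/-- The Laurent polynomial with the given list of coefficients. -/
noncomputable def ev (l : List ℤ) : R := Polynomial.toLaurent (toPoly l)

@[simp] lemma ev_nil : ev [] = 0 := by simp [ev]

lemma ev_addL (l l' : List ℤ) : ev (addL l l') = ev l + ev l' := by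
  simp [ev, toPoly_addL]

lemma ev_mulL (l l' : List ℤ) : ev (mulL l l') = ev l * ev l' := by
  simp [ev, toPoly_mulL]

lemma ev_smulL_neg_one (l : List ℤ) : ev (smulL (-1) l) = -ev l := by
  simp [ev, toPoly_smulL]

lemma ev_ne_zero {l : List ℤ} {a : ℤ} (ha : a ≠ 0) : ev (a :: l) ≠ 0 := fun h =>
  toPoly_ne_zero ha (Polynomial.toLaurent_injective (by simpa [ev] using h))

lemma isUnit_ev_singleton {a : ℤ} (ha : a ≠ 0) : IsUnit (ev [a]) := by
  have h : IsUnit (Polynomial.C (a : ℚ)) :=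
    Polynomial.isUnit_C.2 (isUnit_iff_ne_zero.2 (by exact_mod_cast ha))
  simpa [ev, toPoly] using h.map (Polynomial.toLaurent (R := ℚ))

/-- The entry of a list of lists, with default value `[]`. -/
def entry (L : List (List (List ℤ))) (i j : ℕ) : List ℤ := (L.getD i []).getD j []

/-- The matrix of Laurent polynomials with the given entries. -/
noncomputable def evM (n m : ℕ) (L : List (List (List ℤ))) : Matrix (Fin n) (Fin m) R :=
  Matrix.of fun i j => ev (entry L i j)

/-- Sum of two rows. -/
def addRow : List (List ℤ) → List (List ℤ) → List (List ℤ)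
  | [], r => r
  | a :: r, [] => a :: r
  | a :: r, b :: r' => addL a b :: addRow r r'

/-- Product of a row with a matrix. -/
def mulRow : List (List ℤ) → List (List (List ℤ)) → List (List ℤ)
  | [], _ => []
  | _ :: _, [] => []
  | [] :: r, _ :: M => mulRow r M
  | (c :: a) :: r, b :: M => addRow (b.map (mulL (c :: a))) (mulRow r M)

/-- Product of matrices. -/
def mulM (L M : List (List (List ℤ))) : List (List (List ℤ)) := L.map (mulRow · M)

/-- Sum of matrices. -/
def addM : List (List (List ℤ)) → List (List (List ℤ)) → List (List (List ℤ))
  | [], M => M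
  | a :: L, [] => a :: L
  | a :: L, b :: M => addRow a b :: addM L M

/-- The negative of a matrix. -/
def negM (L : List (List (List ℤ))) : List (List (List ℤ)) := L.map (List.map (smulL (-1)))

/-- The scalar matrix of size `n`. -/
def scalarM (n : ℕ) (u : List ℤ) : List (List (List ℤ)) :=
  (List.range n).map fun i => List.replicate i [] ++ [u]

/-- A scalar multiple of a matrix. -/
def smulM (u : List ℤ) (L : List (List (List ℤ))) : List (List (List ℤ)) :=
  L.map (List.map (mulL u))

/-- Whether all entries of a matrix vanish. -/
def isZeroM (L : List (List (List ℤ))) : Bool := L.all (·.all (·.all (· == 0)))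

lemma ev_getD_addRow (r r' : List (List ℤ)) (j : ℕ) :
    ev ((addRow r r').getD j []) = ev (r.getD j []) + ev (r'.getD j []) := by
  induction r generalizing r' j with
  | nil => simp [addRow]
  | cons a r ih =>
    cases r' with
    | nil => simp [addRow]
    | cons b r' =>
      cases j with
      | zero => simp [addRow, ev_addL]
      | succ j => simpa [addRow] using ih r' j

lemma getD_map_nil {α β : Type*} (f : List α → List β) (hf : f [] = []) (l : List (List α))
    (j : ℕ) : (l.map f).getD j [] = f (l.getD j []) := by
  conv_lhs => rw [← hf]
  exact List.getD_map ..

lemma ev_getD_map_mulL (a : List ℤ) (b : List (List ℤ)) (j : ℕ) :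
    ev ((b.map (mulL a)).getD j []) = ev a * ev (b.getD j []) := by
  induction b generalizing j with
  | nil => simp
  | cons x b ih =>
    cases j with
    | zero => simp [ev_mulL]
    | succ j => simpa using ih j

lemma ev_getD_mulRow (r : List (List ℤ)) (M : List (List (List ℤ))) (j n : ℕ)
    (hn : r.length ≤ n) :
    ev ((mulRow r M).getD j []) = ∑ k ∈ Finset.range n, ev (r.getD k []) * ev (entry M k j) := by
  induction r generalizing M n with
  | nil => simp [mulRow]
  | cons a r ih =>
    cases M with
    | nil => simp [mulRow, entry]
    | cons b M =>
      obtain ⟨n, rfl⟩ : ∃ m, n = m + 1 := ⟨n - 1, by simp at hn; omega⟩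
      have ih' := ih M n (by simpa using hn)
      have key : ev ((mulRow (a :: r) (b :: M)).getD j []) =
          ev a * ev (b.getD j []) + ev ((mulRow r M).getD j []) := by
        cases a with
        | nil => simp [mulRow]
        | cons c a => rw [mulRow, ev_getD_addRow, ev_getD_map_mulL]
      rw [key, ih', Finset.sum_range_succ', add_comm]
      simp [entry]

lemma evM_mulM {n k m : ℕ} {L M : List (List (List ℤ))} (h : L.all (·.length ≤ k)) :
    evM n m (mulM L M) = evM n k L * evM k m M := by
  refine Matrix.ext fun i j => ?_
  simp only [evM, Matrix.of_apply, Matrix.mul_apply]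
  have h1 : entry (mulM L M) i j = (mulRow (L.getD i []) M).getD j [] := by
    rw [entry, mulM, getD_map_nil _ rfl]
  have h2 : (L.getD i []).length ≤ k := by
    rcases lt_or_ge i.1 L.length with hi | hi
    · rw [List.getD_eq_getElem _ _ hi]
      simpa using List.all_eq_true.1 h _ (List.getElem_mem hi)
    · rw [List.getD_eq_default _ _ hi]
      exact Nat.zero_le k
  rw [h1, ev_getD_mulRow _ _ _ k h2, Finset.sum_range]
  rfl

lemma evM_addM (n m : ℕ) (L M : List (List (List ℤ))) :
    evM n m (addM L M) = evM n m L + evM n m M := by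
  refine Matrix.ext fun i j => ?_
  simp only [evM, Matrix.of_apply, Matrix.add_apply, entry]
  generalize i.1 = i'
  induction L generalizing M i' with
  | nil => simp [addM]
  | cons a L ih =>
    cases M with
    | nil => simp [addM]
    | cons b M =>
      cases i' with
      | zero => exact ev_getD_addRow a b j
      | succ i' => simpa [addM] using ih M i'

lemma evM_negM (n m : ℕ) (L : List (List (List ℤ))) : evM n m (negM L) = -evM n m L := by
  refine Matrix.ext fun i j => ?_
  simp only [evM, Matrix.of_apply, Matrix.neg_apply, entry, negM]
  rw [getD_map_nil _ rfl, getD_map_nil _ rfl, ev_smulL_neg_one]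

lemma evM_smulM (n m : ℕ) (u : List ℤ) (L : List (List (List ℤ))) :
    evM n m (smulM u L) = ev u • evM n m L := by
  refine Matrix.ext fun i j => ?_
  simp only [evM, Matrix.of_apply, Matrix.smul_apply, entry, smulM, smul_eq_mul]
  rw [getD_map_nil _ rfl, ev_getD_map_mulL]

lemma evM_scalarM (n : ℕ) (u : List ℤ) : evM n n (scalarM n u) = ev u • 1 := by
  refine Matrix.ext fun i j => ?_
  simp only [evM, Matrix.of_apply, Matrix.smul_apply, entry, scalarM, Matrix.one_apply,
    smul_eq_mul, mul_ite, mul_one, mul_zero]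
  have h : ((List.range n).map fun i => List.replicate i [] ++ [u]).getD i.1 [] =
      List.replicate i.1 [] ++ [u] := by
    simp [List.getD_eq_getElem?_getD]
  rw [h]
  split_ifs with hij
  · subst hij
    simp [List.getD_eq_getElem?_getD]
  · rcases lt_or_gt_of_ne (fun h => hij (Fin.ext h) : i.1 ≠ j.1) with h1 | h1
    · rw [List.getD_eq_default _ _ (by simpa using h1)]
      simp
    · rw [List.getD_append _ _ _ _ (by simpa using h1)]
      simp [List.getD_eq_getElem?_getD, h1]

lemma evM_eq_zero {n m : ℕ} {L : List (List (List ℤ))} (h : isZeroM L) : evM n m L = 0 := by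
  refine Matrix.ext fun i j => ?_
  simp only [evM, Matrix.of_apply, Matrix.zero_apply, entry, ev]
  simp only [isZeroM, List.all_eq_true] at h
  rcases lt_or_ge i.1 L.length with hi | hi
  · rw [List.getD_eq_getElem _ _ hi]
    rcases lt_or_ge j.1 L[i.1].length with hj | hj
    · rw [List.getD_eq_getElem _ _ hj,
        toPoly_eq_zero (List.all_eq_true.2 (h _ (List.getElem_mem hi) _ (List.getElem_mem hj))),
        map_zero]
    · rw [List.getD_eq_default _ _ hj, toPoly_nil, map_zero]
  · rw [List.getD_eq_default _ _ hi, List.getD_nil, toPoly_nil, map_zero]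

lemma evM_eq_of_isZeroM {n m : ℕ} {L M : List (List (List ℤ))} (h : isZeroM (addM L (negM M))) :
    evM n m L = evM n m M := by
  have := evM_eq_zero (n := n) (m := m) h
  rwa [evM_addM, evM_negM, add_neg_eq_zero] at this

/-! ### The root system of type `E₆` -/

/-- The Coxeter matrix of type `E₆`. -/
def mE (i j : Fin 6) : ℕ :=
  if i = j then 1 else
    if (i.1, j.1) ∈ ([(0, 2), (1, 3), (2, 3), (3, 4), (4, 5)] : List (ℕ × ℕ)) ∨
      (j.1, i.1) ∈ ([(0, 2), (1, 3), (2, 3), (3, 4), (4, 5)] : List (ℕ × ℕ)) then 3 else 2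

/-- The action of the simple reflections on the `72` roots. The roots `0, …, 35` are positive and
sorted by height, the roots `0, …, 5` are the simple ones, and `r + 36` is the negative of `r`. -/
def actTable : List (List ℕ) :=
    [[36, 1, 10, 3, 4, 5, 6, 7, 15, 9, 2, 11, 19, 13, 20, 8, 23, 17, 24, 12, 14, 26, 27, 16, 18,
    29, 21, 22, 31, 25, 30, 28, 32, 33, 34, 35, 0, 37, 46, 39, 40, 41, 42, 43, 51, 45, 38, 47, 55,
    49, 56, 44, 59, 53, 60, 48, 50, 62, 63, 52, 54, 65, 57, 58, 67, 61, 66, 64, 68, 69, 70, 71],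
    [0, 37, 2, 9, 4, 5, 6, 13, 14, 3, 10, 17, 18, 7, 8, 20, 21, 11, 12, 24, 15, 16, 22, 26, 19,
    25, 23, 27, 28, 29, 30, 31, 32, 33, 35, 34, 36, 1, 38, 45, 40, 41, 42, 49, 50, 39, 46, 53, 54,
    43, 44, 56, 57, 47, 48, 60, 51, 52, 58, 62, 55, 61, 59, 63, 64, 65, 66, 67, 68, 69, 71, 70],
    [10, 1, 38, 8, 4, 5, 6, 12, 3, 14, 0, 16, 7, 18, 9, 15, 11, 21, 13, 19, 20, 17, 22, 23, 24,
    25, 26, 30, 28, 32, 27, 33, 29, 31, 34, 35, 46, 37, 2, 44, 40, 41, 42, 48, 39, 50, 36, 52, 43,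
    54, 45, 51, 47, 57, 49, 55, 56, 53, 58, 59, 60, 61, 62, 66, 64, 68, 63, 69, 65, 67, 70, 71],
    [0, 9, 8, 39, 7, 5, 11, 4, 2, 1, 15, 6, 12, 13, 14, 10, 16, 17, 22, 19, 20, 25, 18, 23, 27,
    21, 29, 24, 28, 26, 30, 31, 32, 34, 33, 35, 36, 45, 44, 3, 43, 41, 47, 40, 38, 37, 51, 42, 48,
    49, 50, 46, 52, 53, 58, 55, 56, 61, 54, 59, 63, 57, 65, 60, 64, 62, 66, 67, 68, 70, 69, 71],
    [0, 1, 2, 7, 40, 6, 5, 3, 12, 13, 10, 11, 8, 9, 18, 19, 16, 17, 14, 15, 24, 21, 22, 23, 20,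
    28, 26, 27, 25, 31, 30, 29, 33, 32, 34, 35, 36, 37, 38, 43, 4, 42, 41, 39, 48, 49, 46, 47, 44,
    45, 54, 55, 52, 53, 50, 51, 60, 57, 58, 59, 56, 64, 62, 63, 61, 67, 66, 65, 69, 68, 70, 71],
    [0, 1, 2, 3, 6, 41, 4, 11, 8, 9, 10, 7, 16, 17, 14, 15, 12, 13, 21, 23, 20, 18, 25, 19, 26,
    22, 24, 29, 28, 27, 32, 31, 30, 33, 34, 35, 36, 37, 38, 39, 42, 5, 40, 47, 44, 45, 46, 43, 52,
    53, 50, 51, 48, 49, 57, 59, 56, 54, 61, 55, 62, 58, 60, 65, 64, 63, 68, 67, 66, 69, 70, 71]]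

/-- A simple reflection lowering the height of a given positive root that is not simple. -/
def parentTable : List ℕ :=
    [0, 0, 0, 0, 0, 0, 4, 3, 2, 1, 0, 3, 2, 1, 1, 0, 2, 1, 1, 0, 0, 1, 3, 0, 0, 3, 0, 0, 4, 0, 2,
    0, 2, 2, 3, 1]

/-- The supports of the positive roots, as bit masks. -/
def supportTable : List ℕ :=
    [1, 2, 4, 8, 16, 32, 48, 24, 12, 10, 5, 56, 28, 26, 14, 13, 60, 58, 30, 29, 15, 62, 30, 61,
    31, 62, 63, 31, 62, 63, 31, 63, 63, 63, 63, 63]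

/-- The action of a simple reflection on the roots. -/
def act (i : Fin 6) (r : Fin 72) : Fin 72 := Fin.ofNat 72 ((actTable.getD i []).getD r 0)

/-- The simple root with index `i`. -/
def simpleRoot (i : Fin 6) : Fin 72 := Fin.castLE (by norm_num) i

/-- A simple reflection lowering the height of a given positive root that is not simple. -/
def parent (r : Fin 72) : Fin 6 := Fin.ofNat 6 (parentTable.getD r 0)

/-- Whether a simple root occurs in the support of a root. -/
def inSupport (j : Fin 6) (r : Fin 72) : Bool := (supportTable.getD (r % 36) 0).testBit j

lemma act_act : ∀ i r, act i (act i r) = r := by decide +kernel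

lemma act_add : ∀ i r, act i (r + 36) = act i r + 36 := by decide +kernel

lemma act_simpleRoot : ∀ i, act i (simpleRoot i) = simpleRoot i + 36 := by decide +kernel

lemma eq_simpleRoot_of_act : ∀ i r, r.1 < 36 → ¬ (act i r).1 < 36 → r = simpleRoot i := by
  decide +kernel

lemma inSupport_act : ∀ i j r, inSupport j (act i r) → inSupport j r ∨ j = i := by decide +kernel

lemma inSupport_simpleRoot : ∀ i j, inSupport j (simpleRoot i) → j = i := by decide +kernel

lemma braid_act : ∀ i j r, (act i ∘ act j)^[mE i j] r = r := by decide +kernel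

/-- The action of a simple reflection on the roots as a permutation. -/
def actPerm (i : Fin 6) : Equiv.Perm (Fin 72) where
  toFun := act i
  invFun := act i
  left_inv := act_act i
  right_inv := act_act i

lemma isLiftable_actPerm {M : CoxeterMatrix (Fin 6)} (hM : ∀ i j, M i j = mE i j) :
    M.IsLiftable actPerm := by
  intro i j
  ext1 r
  rw [← Equiv.Perm.iterate_eq_pow, hM]
  exact braid_act i j r

lemma coxeterMatrix_eq_mE {M : CoxeterMatrix (Fin 6)}
    (hM : ∀ i j : Fin 6, i.val < j.val →
      M.M i j = (if (i.val, j.val) ∈ ([(0, 2), (1, 3), (2, 3), (3, 4), (4, 5)] : List (ℕ × ℕ))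
        then 3 else 2)) (i j : Fin 6) : M i j = mE i j := by
  have h1 : ∀ i j : Fin 6, i.val < j.val → mE i j =
      (if (i.val, j.val) ∈ ([(0, 2), (1, 3), (2, 3), (3, 4), (4, 5)] : List (ℕ × ℕ))
        then 3 else 2) := by decide +kernel
  have h2 : ∀ i j : Fin 6, mE i j = mE j i := by decide +kernel
  rcases lt_trichotomy i j with h | h | h
  · exact (hM i j h).trans (h1 i j h).symm
  · subst h
    simp [mE]
  · rw [M.symmetric, h2]
    exact (hM j i h).trans (h1 j i h).symm

section RootAction

variable {W : Type*} [Group W] {M : CoxeterMatrix (Fin 6)} (cs : CoxeterSystem M W)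
  (hM : ∀ i j, M i j = mE i j)

/-- The action of the Weyl group on the roots. -/
def rho : W →* Equiv.Perm (Fin 72) := cs.lift ⟨actPerm, isLiftable_actPerm hM⟩

lemma rho_simple (i : Fin 6) (r : Fin 72) : rho cs hM (cs.simple i) r = act i r := by
  rw [rho, cs.lift_apply_simple (isLiftable_actPerm hM)]
  rfl

lemma rho_simple_mul (i : Fin 6) (w : W) (r : Fin 72) :
    rho cs hM (cs.simple i * w) r = act i (rho cs hM w r) := by
  rw [map_mul, Equiv.Perm.mul_apply, rho_simple]

lemma rho_add (w : W) (r : Fin 72) : rho cs hM w (r + 36) = rho cs hM w r + 36 := by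
  induction w using cs.simple_induction_left with
  | one => simp
  | mul_simple_left w i ih => rw [rho_simple_mul, ih, act_add, rho_simple_mul]

lemma add_lt_iff_not_lt : ∀ r : Fin 72, (r + 36).1 < 36 ↔ ¬ r.1 < 36 := by decide +kernel

lemma rho_mul_simple_simpleRoot (w : W) (i : Fin 6) :
    rho cs hM (w * cs.simple i) (simpleRoot i) = rho cs hM w (simpleRoot i) + 36 := by
  rw [map_mul, Equiv.Perm.mul_apply, rho_simple, act_simpleRoot, rho_add]

/-- The reflection in `W` belonging to a positive root. -/
def reflection (r : Fin 72) : W :=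
  if r.1 < 6 then cs.simple (Fin.ofNat 6 r)
  else if (act (parent r) r).1 < r.1 then
    cs.simple (parent r) * reflection (act (parent r) r) * cs.simple (parent r)
  else 1
termination_by r.1

lemma reflection_simpleRoot (i : Fin 6) : reflection cs (simpleRoot i) = cs.simple i := by
  have h : Fin.ofNat 6 (simpleRoot i).1 = i := Fin.ext (Nat.mod_eq_of_lt i.2)
  rw [reflection, if_pos (show (simpleRoot i).1 < 6 from i.2), h]

lemma act_parent_lt : ∀ r : Fin 72, r.1 < 36 → ¬ r.1 < 6 → (act (parent r) r).1 < r.1 := by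
  decide +kernel

lemma reflection_eq {r : Fin 72} (hr : r.1 < 36) (hr' : ¬ r.1 < 6) : reflection cs r =
    cs.simple (parent r) * reflection cs (act (parent r) r) * cs.simple (parent r) := by
  rw [reflection, if_neg hr', if_pos (act_parent_lt r hr hr')]

lemma act_simpleRoot_le : ∀ (i : Fin 6) (r : Fin 72), r.1 < 6 → (act i r).1 ≤ r.1 →
    act i r = r ∧ r = simpleRoot (Fin.ofNat 6 r) ∧ mE i (Fin.ofNat 6 r) = 2 := by
  decide +kernel

lemma act_cases : ∀ (i : Fin 6) (r : Fin 72), r.1 < 36 → ¬ r.1 < 6 → (act i r).1 ≤ r.1 →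
    i = parent r ∨
    (mE i (parent r) = 2 ∧ (act i (act (parent r) r)).1 < r.1 ∧
      act i r = act (parent r) (act i (act (parent r) r)) ∧
      (act i r = r → act i (act (parent r) r) = act (parent r) r)) ∨
    (mE i (parent r) = 3 ∧ act i r = r ∧ (act i (act (parent r) r)).1 < r.1 ∧
      act (parent r) (act i (act (parent r) r)) = act i (act (parent r) r)) ∨
    (mE i (parent r) = 3 ∧ act (parent r) r = simpleRoot i ∧
      act i r = simpleRoot (parent r)) := by
  decide +kernel

include hM in
lemma simple_commute {i j : Fin 6} (h : mE i j = 2) :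
    cs.simple i * cs.simple j = cs.simple j * cs.simple i := by
  have h1 := cs.simple_mul_simple_pow i j
  rw [hM, h, pow_two] at h1
  calc cs.simple i * cs.simple j = (cs.simple i * cs.simple j)⁻¹ :=
        eq_inv_of_mul_eq_one_left h1
    _ = cs.simple j * cs.simple i := by simp

include hM in
lemma simple_braid {i j : Fin 6} (h : mE i j = 3) :
    cs.simple i * cs.simple j * cs.simple i = cs.simple j * cs.simple i * cs.simple j := by
  have h1 := cs.simple_mul_simple_pow i j
  rw [hM, h, pow_succ, pow_two] at h1
  calc cs.simple i * cs.simple j * cs.simple i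
      = (cs.simple j * cs.simple i * cs.simple j)⁻¹ :=
        eq_inv_of_mul_eq_one_left (by simpa [mul_assoc] using h1)
    _ = cs.simple j * cs.simple i * cs.simple j := by simp [mul_assoc]

include hM in
lemma conj_reflection_aux (n : ℕ) (hn : n ≤ 36) : ∀ (i : Fin 6) (r : Fin 72), r.1 < n →
    (act i r).1 < n → cs.simple i * reflection cs r * cs.simple i = reflection cs (act i r) := by
  induction n with
  | zero => exact fun i r hr => absurd hr (Nat.not_lt_zero _)
  | succ n ih =>
    replace ih := ih (by omega)
    suffices key : ∀ (i : Fin 6) (r : Fin 72), r.1 = n → (act i r).1 ≤ r.1 →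
        cs.simple i * reflection cs r * cs.simple i = reflection cs (act i r) by
      intro i r hr har
      by_cases h1 : r.1 < n
      · by_cases h2 : (act i r).1 < n
        · exact ih i r h1 h2
        · have h3 := key i (act i r) (by omega) (by rw [act_act]; omega)
          rw [act_act] at h3
          rw [← h3]
          simp [mul_assoc]
      · exact key i r (by omega) (by omega)
    rintro i r rfl har
    by_cases h6 : r.1 < 6
    · obtain ⟨h1, h2, h3⟩ := act_simpleRoot_le i r h6 har
      rw [h1, h2, reflection_simpleRoot, simple_commute cs hM h3, mul_assoc]
      simp
    have h36 : r.1 < 36 := by omega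
    have hlt := act_parent_lt r h36 h6
    have hr := reflection_eq cs h36 h6
    rcases act_cases i r h36 h6 har with rfl | ⟨hm, h1, h2, h3⟩ | ⟨hm, h1, h2, h3⟩ | ⟨hm, h1, h2⟩
    · rw [hr]
      simp [mul_assoc]
    · have hc := simple_commute cs hM hm
      have e1 := ih i _ hlt h1
      have e2 : cs.simple i * reflection cs r * cs.simple i = cs.simple (parent r) *
          reflection cs (act i (act (parent r) r)) * cs.simple (parent r) := by
        rw [hr, ← e1]
        calc _ = (cs.simple i * cs.simple (parent r)) * reflection cs (act (parent r) r) *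
              (cs.simple (parent r) * cs.simple i) := by simp only [mul_assoc]
          _ = _ := by rw [← hc, hc]; simp only [mul_assoc, hc]
      rw [e2]
      rcases har.lt_or_eq with h | h
      · rw [ih _ _ h1 (by rw [← h2]; exact h), ← h2]
      · have h' : act i r = r := Fin.ext h
        rw [h3 h', h', hr]
    · have hb := simple_braid cs hM hm
      have e1 := ih i _ hlt h2
      have e2 := ih (parent r) _ h2 (by rw [h3]; exact h2)
      rw [h3] at e2
      have e3 : reflection cs (act (parent r) r) =
          cs.simple i * reflection cs (act i (act (parent r) r)) * cs.simple i := by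
        rw [← e1]
        simp [mul_assoc]
      rw [h1, hr, e3]
      calc _ = (cs.simple i * cs.simple (parent r) * cs.simple i) *
              reflection cs (act i (act (parent r) r)) *
              (cs.simple i * cs.simple (parent r) * cs.simple i) := by simp only [mul_assoc]
        _ = cs.simple (parent r) * cs.simple i * (cs.simple (parent r) *
              reflection cs (act i (act (parent r) r)) * cs.simple (parent r)) *
              cs.simple i * cs.simple (parent r) := by rw [hb]; simp only [mul_assoc]
        _ = _ := by rw [e2]; simp only [mul_assoc]
    · have hb := simple_braid cs hM hm
      rw [hr, h1, h2, reflection_simpleRoot, reflection_simpleRoot, ← hb]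
      simp [mul_assoc]

/-- The reflection in `W` belonging to a root. -/
def rootReflection (r : Fin 72) : W := reflection cs (if r.1 < 36 then r else r + 36)

lemma act_eq_of_not_lt : ∀ (i : Fin 6) (r : Fin 72), r.1 < 36 → ¬ (act i r).1 < 36 →
    act i r + 36 = r := by decide +kernel

lemma add_add : ∀ r : Fin 72, r + 36 + 36 = r := by decide +kernel

lemma rootReflection_add (r : Fin 72) : rootReflection cs (r + 36) = rootReflection cs r := by
  have h := add_lt_iff_not_lt r
  by_cases hr : r.1 < 36
  · rw [rootReflection, rootReflection, if_pos hr, if_neg (by tauto), add_add]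
  · rw [rootReflection, rootReflection, if_neg hr, if_pos (by tauto)]

include hM in
lemma conj_rootReflection (i : Fin 6) (r : Fin 72) :
    cs.simple i * rootReflection cs r * cs.simple i = rootReflection cs (act i r) := by
  have key : ∀ r : Fin 72, r.1 < 36 →
      cs.simple i * rootReflection cs r * cs.simple i = rootReflection cs (act i r) := by
    intro r hr
    by_cases h : (act i r).1 < 36
    · rw [rootReflection, rootReflection, if_pos hr, if_pos h]
      exact conj_reflection_aux cs hM 36 le_rfl i r hr h
    · rw [rootReflection, rootReflection, if_pos hr, if_neg h, act_eq_of_not_lt i r hr h,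
        eq_simpleRoot_of_act i r hr h, reflection_simpleRoot]
      simp
  by_cases hr : r.1 < 36
  · exact key r hr
  · have := key (r + 36) ((add_lt_iff_not_lt r).2 hr)
    rwa [rootReflection_add, act_add, rootReflection_add] at this

lemma rootReflection_rho (w : W) (r : Fin 72) :
    rootReflection cs (rho cs hM w r) = w * rootReflection cs r * w⁻¹ := by
  induction w using cs.simple_induction_left with
  | one => simp
  | mul_simple_left w i ih =>
    rw [rho_simple_mul, ← conj_rootReflection cs hM, ih]
    simp [mul_assoc]

lemma rootReflection_simpleRoot (i : Fin 6) :
    rootReflection cs (simpleRoot i) = cs.simple i := by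
  rw [rootReflection, if_pos (show (simpleRoot i).1 < 36 from by
    simp only [simpleRoot, Fin.val_castLE]; omega), reflection_simpleRoot]

lemma simpleRoot_lt (i : Fin 6) : (simpleRoot i).1 < 36 := by
  simp only [simpleRoot, Fin.val_castLE]
  omega

/-- The exchange property, formulated with roots. -/
lemma exists_word_of_neg (ω : List (Fin 6)) (i : Fin 6)
    (h : ¬ (rho cs hM (cs.wordProd ω) (simpleRoot i)).1 < 36) :
    ∃ ω' : List (Fin 6), cs.wordProd ω * cs.simple i = cs.wordProd ω' ∧
      ω'.length + 1 = ω.length := by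
  induction ω with
  | nil => exact absurd (simpleRoot_lt i) (by simpa using h)
  | cons j ω ih =>
    by_cases hβ : (rho cs hM (cs.wordProd ω) (simpleRoot i)).1 < 36
    · rw [cs.wordProd_cons, rho_simple_mul] at h
      have h1 := eq_simpleRoot_of_act j _ hβ h
      have h2 := rootReflection_rho cs hM (cs.wordProd ω) (simpleRoot i)
      rw [h1, rootReflection_simpleRoot, rootReflection_simpleRoot] at h2
      refine ⟨ω, ?_, rfl⟩
      rw [cs.wordProd_cons, h2]
      simp [mul_assoc]
    · obtain ⟨ω', h1, h2⟩ := ih hβ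
      refine ⟨j :: ω', ?_, by simp [h2]⟩
      rw [cs.wordProd_cons, cs.wordProd_cons, mul_assoc, h1]

lemma length_mul_simple_lt {w : W} {i : Fin 6} (h : ¬ (rho cs hM w (simpleRoot i)).1 < 36) :
    cs.length (w * cs.simple i) < cs.length w := by
  obtain ⟨ω, hω, rfl⟩ := cs.exists_isReduced w
  obtain ⟨ω', h1, h2⟩ := exists_word_of_neg cs hM ω i h
  rw [h1, hω.eq]
  have := cs.length_wordProd_le ω'
  omega

lemma length_mul_simple_of_pos {w : W} {i : Fin 6} (h : (rho cs hM w (simpleRoot i)).1 < 36) :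
    cs.length (w * cs.simple i) = cs.length w + 1 := by
  have h1 : ¬ (rho cs hM (w * cs.simple i) (simpleRoot i)).1 < 36 := by
    rw [rho_mul_simple_simpleRoot, add_lt_iff_not_lt]
    simpa using h
  have h2 := length_mul_simple_lt cs hM h1
  rw [cs.simple_mul_simple_cancel_right] at h2
  rcases cs.length_mul_simple w i with h3 | h3 <;> omega

lemma length_mul_simple_of_neg {w : W} {i : Fin 6} (h : ¬ (rho cs hM w (simpleRoot i)).1 < 36) :
    cs.length (w * cs.simple i) + 1 = cs.length w := by
  have h2 := length_mul_simple_lt cs hM h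
  rcases cs.length_mul_simple w i with h3 | h3 <;> omega

lemma eq_one_of_rho {w : W} (h : ∀ i, rho cs hM w (simpleRoot i) = simpleRoot i) : w = 1 := by
  by_contra hw
  obtain ⟨i, hi⟩ := cs.exists_rightDescent_of_ne_one hw
  have := length_mul_simple_of_pos cs hM (w := w) (i := i) (by rw [h]; exact simpleRoot_lt i)
  rw [CoxeterSystem.IsRightDescent] at hi
  omega

lemma eq_of_rho {v w : W}
    (h : ∀ i, rho cs hM v (simpleRoot i) = rho cs hM w (simpleRoot i)) : v = w := by
  have h1 : w⁻¹ * v = 1 := eq_one_of_rho cs hM fun i => by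
    rw [map_mul, Equiv.Perm.mul_apply, h, map_inv]
    simp
  exact (inv_mul_eq_one.1 h1).symm

/-! ### Poincaré polynomials of parabolic subgroups -/

lemma rho_add_iff (w : W) (r : Fin 72) :
    (rho cs hM w (r + 36)).1 < 36 ↔ ¬ (rho cs hM w r).1 < 36 := by
  rw [rho_add, add_lt_iff_not_lt]

/-- The root `r` is supported in `J`. -/
def SuppIn (J : Finset (Fin 6)) (r : Fin 72) : Prop := ∀ j, inSupport j r → j ∈ J

lemma inSupport_add : ∀ j r, inSupport j (r + 36) = inSupport j r := by decide +kernel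

lemma parabolic_induction_left {J : Finset (Fin 6)} {p : W → Prop} (one : p 1)
    (mul : ∀ j ∈ J, ∀ u ∈ parabolic cs J, p u → p (cs.simple j * u)) {u : W}
    (hu : u ∈ parabolic cs J) : p u := by
  induction hu using Subgroup.closure_induction_left with
  | one => exact one
  | mul_left x hx y hy ih =>
    obtain ⟨j, hj, rfl⟩ := hx
    exact mul j hj y hy ih
  | inv_mul_cancel x hx y hy ih =>
    obtain ⟨j, hj, rfl⟩ := hx
    rw [cs.inv_simple]
    exact mul j hj y hy ih

lemma parabolic_induction_right {J : Finset (Fin 6)} {p : W → Prop} (one : p 1)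
    (mul : ∀ j ∈ J, ∀ u ∈ parabolic cs J, p u → p (u * cs.simple j)) {u : W}
    (hu : u ∈ parabolic cs J) : p u := by
  induction hu using Subgroup.closure_induction_right with
  | one => exact one
  | mul_right x hx y hy ih =>
    obtain ⟨j, hj, rfl⟩ := hy
    exact mul j hj x hx ih
  | mul_inv_cancel x hx y hy ih =>
    obtain ⟨j, hj, rfl⟩ := hy
    rw [cs.inv_simple]
    exact mul j hj x hx ih

lemma simple_mem_parabolic {J : Finset (Fin 6)} {j : Fin 6} (hj : j ∈ J) :
    cs.simple j ∈ parabolic cs J :=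
  Subgroup.subset_closure ⟨j, hj, rfl⟩

lemma suppIn_rho {J : Finset (Fin 6)} {u : W} (hu : u ∈ parabolic cs J) {r : Fin 72}
    (hr : SuppIn J r) : SuppIn J (rho cs hM u r) := by
  refine parabolic_induction_left cs (p := fun u => SuppIn J (rho cs hM u r)) (by simpa using hr)
    (fun i hi u _ ih => ?_) hu
  intro j hj
  rw [rho_simple_mul] at hj
  rcases inSupport_act i j _ hj with h | rfl
  · exact ih j h
  · exact hi

end RootAction

section Cosets

variable {W : Type*} [Group W] {M : CoxeterMatrix (Fin 6)} (cs : CoxeterSystem M W)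
  (hM : ∀ i j, M i j = mE i j)

/-- The action of a word in the simple reflections on the roots. -/
def actWord (ω : List (Fin 6)) (r : Fin 72) : Fin 72 := ω.foldr act r

lemma rho_wordProd (ω : List (Fin 6)) (r : Fin 72) :
    rho cs hM (cs.wordProd ω) r = actWord ω r := by
  induction ω with
  | nil => simp [actWord]
  | cons i ω ih => rw [cs.wordProd_cons, rho_simple_mul, ih]; rfl

/-- A criterion for a word to be reduced. -/
def reducedWord : List (Fin 6) → Bool
  | [] => true
  | i :: ω => reducedWord ω && decide ((actWord ω.reverse (simpleRoot i)).1 < 36)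

include hM in
lemma length_wordProd_of_reducedWord {ω : List (Fin 6)} (h : reducedWord ω) :
    cs.length (cs.wordProd ω) = ω.length := by
  induction ω with
  | nil => simp
  | cons i ω ih =>
    simp only [reducedWord, Bool.and_eq_true, decide_eq_true_eq] at h
    rw [← rho_wordProd cs hM, cs.wordProd_reverse] at h
    have := length_mul_simple_of_pos cs hM h.2
    rw [cs.wordProd_cons, ← cs.length_inv, mul_inv_rev, cs.inv_simple, this, cs.length_inv,
      ih h.1, List.length_cons]

/-- The images of the simple roots under a word. -/
def simpleImages (ω : List (Fin 6)) : List (Fin 72) :=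
  (List.finRange 6).map fun i => actWord ω (simpleRoot i)

include hM in
lemma wordProd_eq_iff (ω ω' : List (Fin 6)) :
    cs.wordProd ω = cs.wordProd ω' ↔ simpleImages ω = simpleImages ω' := by
  simp only [simpleImages, List.map_inj_left, List.mem_finRange, true_imp_iff,
    ← rho_wordProd cs hM]
  exact ⟨fun h i => by rw [h], fun h => eq_of_rho cs hM h⟩

include hM in
lemma length_mul_of_preserves_pos {J : Finset (Fin 6)} {w : W}
    (hw : ∀ r : Fin 72, r.1 < 36 → SuppIn J r → (rho cs hM w r).1 < 36) {u : W}
    (hu : u ∈ parabolic cs J) : cs.length (w * u) = cs.length w + cs.length u := by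
  refine parabolic_induction_right cs
    (p := fun u => cs.length (w * u) = cs.length w + cs.length u) (by simp)
    (fun j hj u hu ih => ?_) hu
  have hs : SuppIn J (rho cs hM u (simpleRoot j)) :=
    suppIn_rho cs hM hu fun i hi => inSupport_simpleRoot j i hi ▸ hj
  rw [← mul_assoc]
  by_cases h : (rho cs hM u (simpleRoot j)).1 < 36
  · have h1 := length_mul_simple_of_pos cs hM h
    have h2 := hw _ h hs
    rw [← Equiv.Perm.mul_apply, ← map_mul] at h2
    have h3 := length_mul_simple_of_pos cs hM h2
    omega
  · have h1 := length_mul_simple_of_neg cs hM h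
    have h2 := hw _ ((add_lt_iff_not_lt _).2 h) fun i hi => hs i (by rwa [inSupport_add] at hi)
    rw [rho_add_iff, ← Equiv.Perm.mul_apply, ← map_mul] at h2
    have h3 := length_mul_simple_of_neg cs hM h2
    omega

/-- If `E` is a finite set of representatives for `W_σ / W_J` consisting of elements `a` with
`ℓ(au) = ℓ(a) + ℓ(u)` for `u ∈ W_J`, then the Poincaré polynomial of `W_σ` factors. -/
lemma poin_eq_mul {σ J : Finset (Fin 6)} (hJ : J ⊆ σ) {E : Finset W} (h1 : 1 ∈ E)
    (hE : ∀ a ∈ E, a ∈ parabolic cs σ)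
    (hlen : ∀ a ∈ E, ∀ u ∈ parabolic cs J, cs.length (a * u) = cs.length a + cs.length u)
    (hmul : ∀ t ∈ σ, ∀ a ∈ E, cs.simple t * a ∈ E ∨ ∃ j ∈ J, cs.simple t * a = a * cs.simple j)
    (hfin : (parabolic cs J : Set W).Finite) :
    (parabolic cs σ : Set W).Finite ∧
      poin cs σ = poin cs J * ∑ a ∈ E, (X : ℚ[X]) ^ cs.length a := by
  classical
  have hle : parabolic cs J ≤ parabolic cs σ :=
    Subgroup.closure_mono (Set.image_mono (by exact_mod_cast hJ))
  have hset : (parabolic cs σ : Set W) =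
      ((E ×ˢ hfin.toFinset).image fun p => p.1 * p.2 : Finset W) := by
    ext w
    simp only [Finset.coe_image, Finset.coe_product, Set.mem_image, Set.mem_prod,
      Set.Finite.mem_toFinset, SetLike.mem_coe, Prod.exists]
    constructor
    · refine parabolic_induction_left cs (p := fun w => ∃ a b, (a ∈ E ∧ b ∈ parabolic cs J) ∧
        a * b = w) ⟨1, 1, ⟨h1, one_mem _⟩, one_mul 1⟩ ?_
      rintro t ht _ - ⟨a, u, ⟨ha, hu⟩, rfl⟩
      rcases hmul t ht a ha with h | ⟨j, hj, h⟩
      · exact ⟨_, u, ⟨h, hu⟩, mul_assoc _ _ _⟩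
      · exact ⟨a, cs.simple j * u, ⟨ha, mul_mem (simple_mem_parabolic cs hj) hu⟩, by
          rw [← mul_assoc, ← mul_assoc, h]⟩
    · rintro ⟨a, u, ⟨ha, hu⟩, rfl⟩
      exact mul_mem (hE a ha) (hle hu)
  have hfin' : (parabolic cs σ : Set W).Finite := hset ▸ Finset.finite_toSet _
  have hinj : Set.InjOn (fun p : W × W => p.1 * p.2) (E ×ˢ hfin.toFinset : Finset (W × W)) := by
    rintro ⟨a, u⟩ hau ⟨b, v⟩ hbv h
    simp only [Finset.coe_product, Set.mem_prod, Set.Finite.mem_toFinset,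
      SetLike.mem_coe] at hau hbv h
    have e1 : a * (u * v⁻¹) = b := by rw [← mul_assoc, h, mul_assoc, mul_inv_cancel, mul_one]
    have e2 : b * (v * u⁻¹) = a := by rw [← mul_assoc, ← h, mul_assoc, mul_inv_cancel, mul_one]
    have l1 := hlen a hau.1 _ (mul_mem hau.2 (inv_mem hbv.2))
    have l2 := hlen b hbv.1 _ (mul_mem hbv.2 (inv_mem hau.2))
    rw [e1] at l1
    rw [e2] at l2
    have : u = v := mul_inv_eq_one.1 (cs.length_eq_zero_iff.1 (by omega))
    subst this
    exact Prod.ext (by simpa using e1) rfl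
  refine ⟨hfin', ?_⟩
  have e : hfin'.toFinset = (E ×ˢ hfin.toFinset).image fun p => p.1 * p.2 :=
    Finset.coe_injective (by rw [Set.Finite.coe_toFinset, hset])
  rw [poin, dif_pos hfin', poin, dif_pos hfin, e, Finset.sum_image hinj, mul_comm,
    Finset.sum_mul_sum, ← Finset.sum_product']
  refine Finset.sum_congr rfl fun p hp => ?_
  rw [Finset.mem_product, Set.Finite.mem_toFinset] at hp
  rw [hlen _ hp.1 _ hp.2, pow_add]

/-- The length generating function of a list of words. -/
def lengthPoly : List (List (Fin 6)) → List ℤ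
  | [] => []
  | ω :: D => addL (List.replicate ω.length 0 ++ [1]) (lengthPoly D)

lemma toPoly_replicate_append (n : ℕ) (l : List ℤ) :
    toPoly (List.replicate n 0 ++ l) = X ^ n * toPoly l := by
  induction n with
  | zero => simp
  | succ n ih => simp [List.replicate_succ, toPoly_cons, ih, pow_succ', mul_assoc]

lemma toPoly_lengthPoly (D : List (List (Fin 6))) :
    toPoly (lengthPoly D) = (D.map fun ω => (X : ℚ[X]) ^ ω.length).sum := by
  induction D with
  | nil => rfl
  | cons ω D ih =>
    simp [lengthPoly, toPoly_addL, ih, toPoly_replicate_append, toPoly_cons]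

/-- The subset of `Fin 6` encoded by a bit mask. -/
def face (m : ℕ) : Finset (Fin 6) := Finset.univ.filter fun i => m.testBit i

lemma mem_face {m : ℕ} {i : Fin 6} : i ∈ face m ↔ m.testBit i = true := by simp [face]

/-- A root is supported in the face given by a bit mask. -/
def suppInMask (m : ℕ) (r : Fin 72) : Bool :=
  (List.finRange 6).all fun j => !inSupport j r || m.testBit j

lemma suppInMask_iff {m : ℕ} {r : Fin 72} : suppInMask m r ↔ SuppIn (face m) r := by
  simp [suppInMask, SuppIn, mem_face, imp_iff_not_or]

/-- A decidable criterion for the words in `D` to be the minimal representatives of the cosets of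
the parabolic subgroup for the bit mask `m'` in the one for the bit mask `m`. -/
def IsCosetSystem (m m' : ℕ) (D : List (List (Fin 6))) : Prop :=
  (∀ i : Fin 6, m'.testBit i = true → m.testBit i = true) ∧
  [] ∈ D ∧ (∀ ω ∈ D, reducedWord ω ∧ ∀ t ∈ ω, m.testBit t.1 = true) ∧
  (∀ ω ∈ D, ∀ r : Fin 72, r.1 < 36 → suppInMask m' r → (actWord ω r).1 < 36) ∧
  (D.map simpleImages).Nodup ∧
  (∀ t : Fin 6, m.testBit t = true → ∀ ω ∈ D, simpleImages (t :: ω) ∈ D.map simpleImages ∨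
    ∃ j : Fin 6, m'.testBit j = true ∧ simpleImages (t :: ω) = simpleImages (ω ++ [j]))

instance (m m' : ℕ) (D : List (List (Fin 6))) : Decidable (IsCosetSystem m m' D) := by
  unfold IsCosetSystem
  infer_instance

include hM in
lemma poin_of_isCosetSystem {m m' : ℕ} {D : List (List (Fin 6))} (h : IsCosetSystem m m' D)
    (hfin : (parabolic cs (face m') : Set W).Finite) :
    (parabolic cs (face m) : Set W).Finite ∧
      poin cs (face m) = poin cs (face m') * toPoly (lengthPoly D) := by
  classical
  obtain ⟨hsub, hnil, hred, hpos, hnd, hmul⟩ := h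
  have hnd' : (D.map cs.wordProd).Nodup :=
    List.Nodup.map_on (fun ω hω ω' hω' e => List.inj_on_of_nodup_map hnd hω hω'
      ((wordProd_eq_iff cs hM _ _).1 e)) (List.Nodup.of_map _ hnd)
  have key := poin_eq_mul cs (σ := face m) (J := face m') (E := (D.map cs.wordProd).toFinset)
    (fun i hi => mem_face.2 (hsub i (mem_face.1 hi)))
    (by simpa using ⟨[], hnil, rfl⟩) ?_ ?_ ?_ hfin
  · refine ⟨key.1, ?_⟩
    rw [key.2, List.sum_toFinset _ hnd', List.map_map, toPoly_lengthPoly]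
    congr 2
    refine List.map_congr_left fun ω hω => ?_
    rw [Function.comp_apply, length_wordProd_of_reducedWord cs hM (hred ω hω).1]
  · intro a ha
    obtain ⟨ω, hω, rfl⟩ := by simpa using ha
    refine Subgroup.list_prod_mem _ fun x hx => ?_
    obtain ⟨t, ht, rfl⟩ := List.mem_map.1 hx
    exact simple_mem_parabolic cs (mem_face.2 ((hred ω hω).2 t ht))
  · intro a ha u hu
    obtain ⟨ω, hω, rfl⟩ := by simpa using ha
    refine length_mul_of_preserves_pos cs hM (fun r hr hs => ?_) hu
    rw [rho_wordProd]
    exact hpos ω hω r hr (suppInMask_iff.2 hs)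
  · intro t ht a ha
    obtain ⟨ω, hω, rfl⟩ := by simpa using ha
    rw [← cs.wordProd_cons]
    rcases hmul t (mem_face.1 ht) ω hω with h | ⟨j, hj, h⟩
    · obtain ⟨ω', hω', e⟩ := List.mem_map.1 h
      refine Or.inl (List.mem_toFinset.2 (List.mem_map.2 ⟨ω', hω', ?_⟩))
      exact (wordProd_eq_iff cs hM _ _).2 e
    · refine Or.inr ⟨j, mem_face.2 hj, ?_⟩
      rw [(wordProd_eq_iff cs hM _ _).2 h, cs.wordProd_append, cs.wordProd_singleton]

/-- For each nonempty bit mask a simple reflection to be removed. -/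
def removeTable : List (Fin 6) :=
    [0, 0, 1, 0, 2, 0, 1, 1, 3, 0, 1, 0, 2, 0, 1, 0, 4, 0, 1, 0, 2, 4, 1, 1, 3, 0, 1, 0, 2, 0, 1,
    0, 5, 0, 1, 0, 2, 5, 1, 1, 3, 0, 5, 0, 5, 5, 5, 5, 4, 0, 1, 0, 2, 0, 1, 1, 3, 0, 1, 0, 2, 0,
    5, 0]

/-- For each bit mask minimal coset representatives for the parabolic subgroup obtained by removing
the simple reflection given by `removeTable`. -/
def cosetTable : List (List (List (Fin 6))) :=
    [[], [[], [0]], [[], [1]], [[], [0]], [[], [2]], [[], [0], [2, 0]], [[], [1]], [[], [1]], [[],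
    [3]], [[], [0]], [[], [1], [3, 1]], [[], [0]], [[], [2], [3, 2]], [[], [0], [2, 0], [3, 2,
    0]], [[], [1], [3, 1], [2, 3, 1]], [[], [0], [2, 0], [3, 2, 0], [1, 3, 2, 0]], [[], [4]], [[],
    [0]], [[], [1]], [[], [0]], [[], [2]], [[], [4]], [[], [1]], [[], [1]], [[], [3], [4, 3]],
    [[], [0]], [[], [1], [3, 1], [4, 3, 1]], [[], [0]], [[], [2], [3, 2], [4, 3, 2]], [[], [0],
    [2, 0], [3, 2, 0], [4, 3, 2, 0]], [[], [1], [3, 1], [2, 3, 1], [4, 3, 1], [4, 2, 3, 1], [3, 4,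
    2, 3, 1], [1, 3, 4, 2, 3, 1]], [[], [0], [2, 0], [3, 2, 0], [1, 3, 2, 0], [4, 3, 2, 0], [4, 1,
    3, 2, 0], [3, 4, 1, 3, 2, 0], [2, 3, 4, 1, 3, 2, 0], [0, 2, 3, 4, 1, 3, 2, 0]], [[], [5]],
    [[], [0]], [[], [1]], [[], [0]], [[], [2]], [[], [5]], [[], [1]], [[], [1]], [[], [3]], [[],
    [0]], [[], [5]], [[], [0]], [[], [5]], [[], [5]], [[], [5]], [[], [5]], [[], [4], [5, 4]],
    [[], [0]], [[], [1]], [[], [0]], [[], [2]], [[], [0], [2, 0]], [[], [1]], [[], [1]], [[], [3],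
    [4, 3], [5, 4, 3]], [[], [0]], [[], [1], [3, 1], [4, 3, 1], [5, 4, 3, 1]], [[], [0]], [[],
    [2], [3, 2], [4, 3, 2], [5, 4, 3, 2]], [[], [0], [2, 0], [3, 2, 0], [4, 3, 2, 0], [5, 4, 3, 2,
    0]], [[], [5], [4, 5], [3, 4, 5], [1, 3, 4, 5], [2, 3, 4, 5], [2, 1, 3, 4, 5], [3, 2, 1, 3, 4,
    5], [4, 3, 2, 1, 3, 4, 5], [5, 4, 3, 2, 1, 3, 4, 5]], [[], [0], [2, 0], [3, 2, 0], [1, 3, 2,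
    0], [4, 3, 2, 0], [4, 1, 3, 2, 0], [5, 4, 3, 2, 0], [3, 4, 1, 3, 2, 0], [5, 4, 1, 3, 2, 0],
    [2, 3, 4, 1, 3, 2, 0], [5, 3, 4, 1, 3, 2, 0], [0, 2, 3, 4, 1, 3, 2, 0], [5, 2, 3, 4, 1, 3, 2,
    0], [4, 5, 3, 4, 1, 3, 2, 0], [5, 0, 2, 3, 4, 1, 3, 2, 0], [4, 5, 2, 3, 4, 1, 3, 2, 0], [4, 5,
    0, 2, 3, 4, 1, 3, 2, 0], [3, 4, 5, 2, 3, 4, 1, 3, 2, 0], [3, 4, 5, 0, 2, 3, 4, 1, 3, 2, 0],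
    [1, 3, 4, 5, 2, 3, 4, 1, 3, 2, 0], [1, 3, 4, 5, 0, 2, 3, 4, 1, 3, 2, 0], [2, 3, 4, 5, 0, 2, 3,
    4, 1, 3, 2, 0], [2, 1, 3, 4, 5, 0, 2, 3, 4, 1, 3, 2, 0], [3, 2, 1, 3, 4, 5, 0, 2, 3, 4, 1, 3,
    2, 0], [4, 3, 2, 1, 3, 4, 5, 0, 2, 3, 4, 1, 3, 2, 0], [5, 4, 3, 2, 1, 3, 4, 5, 0, 2, 3, 4, 1,
    3, 2, 0]]]

/-- For each bit mask the degrees of the corresponding parabolic subgroup. -/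
def degreeTable : List (List ℕ) :=
    [[], [2], [2], [2, 2], [2], [2, 3], [2, 2], [2, 2, 3], [2], [2, 2], [2, 3], [2, 2, 3], [2, 3],
    [2, 3, 4], [2, 3, 4], [2, 3, 4, 5], [2], [2, 2], [2, 2], [2, 2, 2], [2, 2], [2, 2, 3], [2, 2,
    2], [2, 2, 2, 3], [2, 3], [2, 2, 3], [2, 3, 4], [2, 2, 3, 4], [2, 3, 4], [2, 3, 4, 5], [2, 4,
    4, 6], [2, 4, 5, 6, 8], [2], [2, 2], [2, 2], [2, 2, 2], [2, 2], [2, 2, 3], [2, 2, 2], [2, 2,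
    2, 3], [2, 2], [2, 2, 2], [2, 2, 3], [2, 2, 2, 3], [2, 2, 3], [2, 2, 3, 4], [2, 2, 3, 4], [2,
    2, 3, 4, 5], [2, 3], [2, 2, 3], [2, 2, 3], [2, 2, 2, 3], [2, 2, 3], [2, 2, 3, 3], [2, 2, 2,
    3], [2, 2, 2, 3, 3], [2, 3, 4], [2, 2, 3, 4], [2, 3, 4, 5], [2, 2, 3, 4, 5], [2, 3, 4, 5], [2,
    3, 4, 5, 6], [2, 4, 5, 6, 8], [2, 5, 6, 8, 9, 12]]

/-- The coefficients of the Poincaré polynomial of the parabolic subgroup given by a bit mask. -/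
def poinList (m : ℕ) : List ℤ :=
  ((degreeTable.getD m []).map fun d => List.replicate d 1).foldr mulL [1]

/-- The bit mask obtained by removing the simple reflection given by `removeTable`. -/
def smallerMask (m : ℕ) : ℕ := m - 2 ^ (removeTable.getD m 0).1

lemma isCosetSystem_table : ∀ m < 64, m ≠ 0 → smallerMask m < m ∧
    IsCosetSystem m (smallerMask m) (cosetTable.getD m []) ∧
    eqL (poinList m) (mulL (poinList (smallerMask m)) (lengthPoly (cosetTable.getD m []))) := by
  decide +kernel

include hM in
theorem poin_face {m : ℕ} (hm : m < 64) : (parabolic cs (face m) : Set W).Finite ∧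
    poin cs (face m) = toPoly (poinList m) := by
  induction m using Nat.strong_induction_on with
  | _ m ih =>
    by_cases h0 : m = 0
    · subst h0
      have hf : face 0 = ∅ := by simp [face]
      have hb : (parabolic cs ∅ : Set W) = {1} := by simp [parabolic]
      have hfin : (parabolic cs ∅ : Set W).Finite := hb ▸ Set.finite_singleton 1
      have he : hfin.toFinset = {1} := Finset.coe_injective (by
        rw [Set.Finite.coe_toFinset, hb, Finset.coe_singleton])
      rw [hf]
      refine ⟨hfin, ?_⟩
      rw [poin, dif_pos hfin, he, Finset.sum_singleton]
      simp [poinList, degreeTable, toPoly_cons]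
    · obtain ⟨h1, h2, h3⟩ := isCosetSystem_table m hm h0
      obtain ⟨h4, h5⟩ := ih _ h1 (h1.trans hm)
      obtain ⟨h6, h7⟩ := poin_of_isCosetSystem cs hM h2 h4
      refine ⟨h6, ?_⟩
      rw [h7, h5, toPoly_eq_of_eqL h3, toPoly_mulL]

end Cosets

/-! ### Products of cyclotomic polynomials -/

lemma cyclotomic_eight : cyclotomic 8 ℚ = X ^ 4 + 1 := by
  rw [show 8 = 2 * 2 * 2 from rfl, ← cyclotomic_expand_eq_cyclotomic Nat.prime_two (by norm_num),
    ← cyclotomic_expand_eq_cyclotomic Nat.prime_two (dvd_refl 2), cyclotomic_two]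
  simp only [map_add, expand_X, map_one, map_pow]
  ring

lemma cyclotomic_nine : cyclotomic 9 ℚ = X ^ 6 + X ^ 3 + 1 := by
  rw [show 9 = 3 * 3 from rfl, ← cyclotomic_expand_eq_cyclotomic Nat.prime_three (dvd_refl 3),
    cyclotomic_three]
  simp only [map_add, expand_X, map_one, map_pow]
  ring

lemma cyclotomic_twelve : cyclotomic 12 ℚ = X ^ 4 - X ^ 2 + 1 := by
  rw [show 12 = 6 * 2 from rfl, ← cyclotomic_expand_eq_cyclotomic Nat.prime_two (by norm_num),
    cyclotomic_six]
  simp only [map_add, map_sub, expand_X, map_one, map_pow]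
  ring

lemma ev_eq_cyc_two : ev [1, 1] = cyc 2 := by
  simp [ev, cyc, toPoly_cons, cyclotomic_two, add_comm]

lemma ev_eq_cyc_six_mul : ev [1, -1, 1, 0, 1, -1, 1] = cyc 6 * cyc 8 := by
  rw [ev, cyc, cyc, ← map_mul, cyclotomic_six, cyclotomic_eight]
  congr 1
  simp only [toPoly_cons, toPoly_nil, Int.cast_one, Int.cast_neg, Int.cast_zero, map_one, map_neg,
    map_zero]
  ring

lemma ev_eq_cyc_three_mul :
    ev [1, 0, 0, 1, 1, 0, 1, 1, 1, 0, 1, 1, 0, 0, 1] = cyc 3 * (cyc 6 * (cyc 9 * cyc 12)) := by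
  rw [ev, cyc, cyc, cyc, cyc, ← map_mul, ← map_mul, ← map_mul, cyclotomic_three, cyclotomic_six,
    cyclotomic_nine, cyclotomic_twelve]
  congr 1
  simp only [toPoly_cons, toPoly_nil, Int.cast_one, Int.cast_zero, map_one, map_zero]
  ring

/-! ### The weighted complex as a sequence of explicit matrices -/

/-- For each `k` the bit masks of the faces with `k` elements, in lexicographic order. -/
def faceTable : List (List ℕ) :=
    [[0], [1, 2, 4, 8, 16, 32], [3, 5, 9, 17, 33, 6, 10, 18, 34, 12, 20, 36, 24, 40, 48], [7, 11,
    19, 35, 13, 21, 37, 25, 41, 49, 14, 22, 38, 26, 42, 50, 28, 44, 52, 56], [15, 23, 39, 27, 43,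
    51, 29, 45, 53, 57, 30, 46, 54, 58, 60], [31, 47, 55, 59, 61, 62], [63]]

/-- The matrices of the boundary maps. -/
def boundaryTable : List (List (List (List ℤ))) :=
    [[[[1, 1], [1, 1], [1, 1], [1, 1], [1, 1], [1, 1]]], [[[-1, -1], [-1, -1, -1], [-1, -1], [-1,
    -1], [-1, -1]], [[1, 1], [], [], [], [], [-1, -1], [-1, -1, -1], [-1, -1], [-1, -1]], [[], [1,
    1, 1], [], [], [], [1, 1], [], [], [], [-1, -1, -1], [-1, -1], [-1, -1]], [[], [], [1, 1], [],
    [], [], [1, 1, 1], [], [], [1, 1, 1], [], [], [-1, -1, -1], [-1, -1]], [[], [], [], [1, 1],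
    [], [], [], [1, 1], [], [], [1, 1], [], [1, 1, 1], [], [-1, -1, -1]], [[], [], [], [], [1, 1],
    [], [], [], [1, 1], [], [], [1, 1], [], [1, 1], [1, 1, 1]]], [[[1, 1, 1], [1, 1, 1], [1, 1],
    [1, 1]], [[-1, -1], [], [], [], [1, 1, 1, 1], [1, 1], [1, 1]], [[], [-1, -1, -1], [], [], [-1,
    -1, -2, -1, -1], [], [], [1, 1, 1], [1, 1]], [[], [], [-1, -1], [], [], [-1, -1, -1], [], [-1,
    -1, -1], [], [1, 1, 1]], [[], [], [], [-1, -1], [], [], [-1, -1, -1], [], [-1, -1], [-1, -1,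
    -1]], [[1, 1, 1], [], [], [], [], [], [], [], [], [], [1, 1, 2, 1, 1], [1, 1], [1, 1]], [[],
    [1, 1], [], [], [], [], [], [], [], [], [-1, -1, -1, -1], [], [], [1, 1, 1, 1], [1, 1]], [[],
    [], [1, 1], [], [], [], [], [], [], [], [], [-1, -1], [], [-1, -1, -2, -1, -1], [], [1, 1,
    1]], [[], [], [], [1, 1], [], [], [], [], [], [], [], [], [-1, -1], [], [-1, -1, -1], [-1, -1,
    -1]], [[], [], [], [], [1, 1, 1, 1], [], [], [], [], [], [1, 1, 1, 1], [], [], [], [], [], [1,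
    1, 1, 1], [1, 1]], [[], [], [], [], [], [1, 1, 1], [], [], [], [], [], [1, 1], [], [], [], [],
    [-1, -1, -2, -1, -1], [], [1, 1, 1]], [[], [], [], [], [], [], [1, 1, 1], [], [], [], [], [],
    [1, 1], [], [], [], [], [-1, -1, -1], [-1, -1, -1]], [[], [], [], [], [], [], [], [1, 1], [],
    [], [], [], [], [1, 1, 1, 1], [], [], [1, 1, 1, 1], [], [], [1, 1, 1, 1]], [[], [], [], [],
    [], [], [], [], [1, 1], [], [], [], [], [], [1, 1, 1], [], [], [1, 1, 1], [], [-1, -1, -2, -1,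
    -1]], [[], [], [], [], [], [], [], [], [], [1, 1], [], [], [], [], [], [1, 1], [], [], [1, 1],
    [1, 1, 1, 1]]], [[[-1, -1, -2, -2, -2, -1, -1], [-1, -1], [-1, -1]], [[1, 1, 2, 2, 2, 1, 1],
    [], [], [-1, -1, -1, -1], [-1, -1]], [[], [1, 1, 1], [], [1, 1, 2, 1, 1], [], [-1, -1, -1]],
    [[], [], [1, 1, 1], [], [1, 1, 1], [1, 1, 1]], [[-1, -1, -1, -1, -1], [], [], [], [], [], [-1,
    -1, -1, -1, -1], [-1, -1]], [[], [-1, -1], [], [], [], [], [1, 1, 2, 2, 2, 1, 1], [], [-1, -1,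
    -1]], [[], [], [-1, -1], [], [], [], [], [1, 1, 1, 1], [1, 1, 1]], [[], [], [], [-1, -1, -1,
    -1], [], [], [-1, -1, -2, -2, -2, -1, -1], [], [], [-1, -1, -1, -1]], [[], [], [], [], [-1,
    -1, -1], [], [], [-1, -1, -2, -1, -1], [], [1, 1, 2, 1, 1]], [[], [], [], [], [], [-1, -1],
    [], [], [-1, -1, -1], [-1, -1, -1, -1]], [[1, 1, 1, 1, 1], [], [], [], [], [], [], [], [], [],
    [-1, -1, -1, -2, -1, -1, -1], [-1, -1]], [[], [1, 1, 1], [], [], [], [], [], [], [], [], [1,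
    1, 3, 3, 4, 4, 3, 3, 1, 1], [], [-1, -1, -1]], [[], [], [1, 1, 1], [], [], [], [], [], [], [],
    [], [1, 1, 2, 1, 1], [1, 1, 1]], [[], [], [], [1, 1], [], [], [], [], [], [], [-1, -1, -1, -2,
    -1, -1, -1], [], [], [-1, -1, -1, -1, -1]], [[], [], [], [], [1, 1], [], [], [], [], [], [],
    [-1, -1, -1, -1], [], [1, 1, 2, 2, 2, 1, 1]], [[], [], [], [], [], [1, 1], [], [], [], [], [],
    [], [-1, -1], [-1, -1, -2, -2, -2, -1, -1]], [[], [], [], [], [], [], [1, 1, 1, 1, 1], [], [],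
    [], [1, 1, 1, 2, 1, 1, 1], [], [], [], [-1, -1, -1, -1, -1]], [[], [], [], [], [], [], [], [1,
    1, 1, 1], [], [], [], [1, 1, 1, 1], [], [], [1, 1, 2, 2, 2, 1, 1]], [[], [], [], [], [], [],
    [], [], [1, 1, 1], [], [], [], [1, 1], [], [-1, -1, -2, -2, -2, -1, -1]], [[], [], [], [], [],
    [], [], [], [], [1, 1], [], [], [], [1, 1, 1, 1, 1], [1, 1, 1, 1, 1]]], [[[1, 1, 1, 2, 2, 2,
    2, 2, 1, 1, 1], [1, 1]], [[-1, -1, -3, -4, -6, -7, -9, -9, -9, -9, -7, -6, -4, -3, -1, -1],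
    [], [1, 1, 1]], [[], [-1, -1, -2, -2, -2, -1, -1], [-1, -1, -1]], [[1, 1, 2, 3, 4, 4, 5, 5, 4,
    4, 3, 2, 1, 1], [], [], [1, 1, 1, 1, 1]], [[], [1, 1, 2, 2, 2, 1, 1], [], [-1, -1, -2, -2, -2,
    -1, -1]], [[], [], [1, 1, 1], [1, 1, 2, 2, 2, 1, 1]], [[-1, -1, -1, -2, -2, -2, -2, -2, -1,
    -1, -1], [], [], [], [1, 1, 1, 1, 1, 1]], [[], [-1, -1, -1, -1, -1], [], [], [-1, -1, -2, -2,
    -3, -2, -2, -1, -1]], [[], [], [-1, -1], [], [1, 1, 2, 3, 3, 3, 3, 2, 1, 1]], [[], [], [],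
    [-1, -1, -1, -1, -1], [-1, -1, -2, -2, -3, -2, -2, -1, -1]], [[1, 1, 1, 1, 2, 1, 1, 1, 1], [],
    [], [], [], [1, 1, 1, 1, 2, 1, 1, 1, 1]], [[], [1, 1, 1, 1, 1], [], [], [], [-1, -1, -2, -3,
    -4, -4, -5, -5, -4, -4, -3, -2, -1, -1]], [[], [], [1, 1, 1], [], [], [1, 1, 3, 4, 6, 7, 9, 9,
    9, 9, 7, 6, 4, 3, 1, 1]], [[], [], [], [1, 1], [], [-1, -1, -1, -2, -2, -2, -2, -2, -1, -1,
    -1]], [[], [], [], [], [1, 1, 1, 1, 1, 1], [1, 1, 1, 2, 2, 2, 2, 2, 1, 1, 1]]], [[[-1, -1, -1,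
    -1, -2, -2, -2, -2, -3, -2, -2, -2, -2, -1, -1, -1, -1]], [[1, 1, 2, 3, 5, 6, 8, 10, 12, 13,
    15, 16, 16, 16, 16, 15, 13, 12, 10, 8, 6, 5, 3, 2, 1, 1]], [[-1, -1, -3, -5, -8, -11, -17,
    -21, -27, -33, -39, -43, -48, -51, -52, -52, -51, -48, -43, -39, -33, -27, -21, -17, -11, -8,
    -5, -3, -1, -1]], [[1, 1, 2, 3, 5, 6, 8, 10, 12, 13, 15, 16, 16, 16, 16, 15, 13, 12, 10, 8, 6,
    5, 3, 2, 1, 1]], [[-1, -1, -1, -2, -3, -3, -4, -5, -5, -5, -6, -6, -5, -5, -5, -4, -3, -3, -2,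
    -1, -1, -1]], [[1, 1, 1, 1, 2, 2, 2, 2, 3, 2, 2, 2, 2, 1, 1, 1, 1]]]]

/-- The bit masks of the faces with `k` elements. -/
def faceMasks (k : ℕ) : List ℕ := faceTable.getD k []

/-- The matrix of the boundary map from degree `k + 1` to degree `k`. -/
def boundary (k : ℕ) : List (List (List ℤ)) := boundaryTable.getD k []

/-- The matrix of the boundary map from degree `k + 1` to degree `k`. -/
noncomputable def boundaryMatrix (k : ℕ) :
    Matrix (Fin (faceMasks k).length) (Fin (faceMasks (k + 1)).length) R :=
  evM _ _ (boundary k)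

/-- The cycles of the sequence of matrices `boundaryMatrix`. -/
noncomputable def matrixCycles : (k : ℕ) → Submodule R (Fin (faceMasks k).length → R)
  | 0 => ⊤
  | k + 1 => LinearMap.ker (boundaryMatrix k).mulVecLin

lemma faceMasks_spec : ∀ k < 7, ((faceMasks k).map face).Nodup ∧
    ∀ m ∈ faceMasks k, m < 64 ∧ (face m).card = k := by
  decide +kernel

lemma mem_faceMasks : ∀ σ : Finset (Fin 6), σ ∈ (faceMasks σ.card).map face := by
  decide +kernel

/-- The entries of the boundary matrices are quotients of Poincaré polynomials. -/
lemma boundary_spec : ∀ k < 7, ∀ i : Fin (faceMasks k).length,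
    ∀ j : Fin (faceMasks (k + 1)).length,
    (∀ s ∈ face ((faceMasks (k + 1)).get j),
      face ((faceMasks k).get i) = (face ((faceMasks (k + 1)).get j)).erase s →
      (poinList ((faceMasks k).get i)).head? = some 1 ∧
      eqL (poinList ((faceMasks (k + 1)).get j))
        (mulL (smulL ((-1) ^ ((face ((faceMasks (k + 1)).get j)).filter fun t => t < s).card)
          (entry (boundary k) i j)) (poinList ((faceMasks k).get i)))) ∧
    ((∀ s ∈ face ((faceMasks (k + 1)).get j),
      face ((faceMasks k).get i) ≠ (face ((faceMasks (k + 1)).get j)).erase s) →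
      entry (boundary k) i j = []) := by
  decide +kernel

section Reindex

variable {A : Type*} [CommRing A] {α β α' β' : Type*}
  [Fintype α] [Fintype α']

lemma nonempty_seqHomology_reindex (e : β' ≃ β) (f : α' ≃ α) (M : Matrix β α A)
    {Z : Submodule A (β → A)} {Z' : Submodule A (β' → A)}
    (hZ : Z' = Z.map (LinearEquiv.funCongrLeft A A e : (β → A) →ₗ[A] (β' → A))) :
    Nonempty (SeqHomology M Z ≃ₗ[A] SeqHomology (M.submatrix e f) Z') := by
  subst hZ
  refine ⟨Submodule.Quotient.equiv _ _ ((LinearEquiv.funCongrLeft A A e).submoduleMap Z) ?_⟩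
  have key : ∀ w : α → A, (M.submatrix e f).mulVec (w ∘ f) = (M.mulVec w) ∘ e := fun w => by
    rw [Matrix.submatrix_mulVec_equiv]
    simp [Function.comp_assoc]
  ext ⟨x, hx⟩
  obtain ⟨x, hx, rfl⟩ := hx
  simp only [Submodule.mem_map, Submodule.mem_comap]
  constructor
  · rintro ⟨⟨y, hy⟩, ⟨w, hw⟩, hyx⟩
    have hyx' : y ∘ e = x ∘ e := congrArg Subtype.val hyx
    refine ⟨w ∘ f, ?_⟩
    change M.mulVec w = y at hw
    change (M.submatrix e f).mulVec (w ∘ f) = x ∘ e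
    rw [key, hw, hyx']
  · rintro ⟨w, hw⟩
    refine ⟨⟨x, hx⟩, ⟨w ∘ f.symm, ?_⟩, rfl⟩
    change (M.submatrix e f).mulVec w = x ∘ e at hw
    have h := key (w ∘ f.symm)
    rw [Function.comp_assoc, Equiv.symm_comp_self, Function.comp_id, hw] at h
    exact (e.surjective.injective_comp_right h).symm

lemma ker_submatrix_mulVecLin (e : β' ≃ β) (f : α' ≃ α) (M : Matrix β α A) :
    LinearMap.ker (M.submatrix e f).mulVecLin = (LinearMap.ker M.mulVecLin).map
      (LinearEquiv.funCongrLeft A A f : (α → A) →ₗ[A] (α' → A)) := by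
  ext x
  have key : (M.submatrix e f).mulVec x = M.mulVec (x ∘ f.symm) ∘ e :=
    Matrix.submatrix_mulVec_equiv _ _ _ _
  simp only [Submodule.mem_map, LinearMap.mem_ker, Matrix.mulVecLin_apply, key]
  constructor
  · intro h
    exact ⟨x ∘ f.symm, e.surjective.injective_comp_right h, by
      ext i
      simp [LinearEquiv.funCongrLeft]⟩
  · rintro ⟨y, hy, rfl⟩
    have : ((LinearEquiv.funCongrLeft A A f : (α → A) →ₗ[A] (α' → A)) y) ∘ f.symm = y := by
      ext i
      simp [LinearEquiv.funCongrLeft]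
    rw [this, hy]
    rfl

end Reindex

section Complex

variable {W : Type*} [Group W] {M : CoxeterMatrix (Fin 6)} (cs : CoxeterSystem M W)
  (hM : ∀ i j, M i j = mE i j)

/-- The enumeration of the faces of the weighted complex. -/
def faceMap {k : ℕ} (hk : k < 7) (i : Fin (faceMasks k).length) : KW cs k :=
  ⟨face ((faceMasks k).get i), ((faceMasks_spec k hk).2 _ (List.get_mem _ _)).2,
    (poin_face cs hM ((faceMasks_spec k hk).2 _ (List.get_mem _ _)).1).1⟩

lemma bijective_faceMap {k : ℕ} (hk : k < 7) : Function.Bijective (faceMap cs hM hk) := by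
  constructor
  · intro i j h
    have h1 : face ((faceMasks k).get i) = face ((faceMasks k).get j) := congrArg Subtype.val h
    have h2 := List.inj_on_of_nodup_map (faceMasks_spec k hk).1 (List.get_mem _ _)
      (List.get_mem _ _) h1
    exact List.nodup_iff_injective_get.1 (List.Nodup.of_map _ (faceMasks_spec k hk).1) h2
  · rintro ⟨σ, rfl, hσ⟩
    obtain ⟨m, hm, hm'⟩ := List.mem_map.1 (mem_faceMasks σ)
    obtain ⟨i, hi⟩ := List.get_of_mem hm
    exact ⟨i, Subtype.ext ((congrArg face hi).trans hm')⟩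

include hM in
lemma nonempty_face_equiv (k : ℕ) : ∃ e : Fin (faceMasks k).length ≃ KW cs k,
    ∀ i, (e i).1 = face ((faceMasks k).get i) := by
  by_cases hk : k < 7
  · exact ⟨Equiv.ofBijective _ (bijective_faceMap cs hM hk), fun i => rfl⟩
  · have h1 : faceMasks k = [] := by
      rw [faceMasks, List.getD_eq_default _ _ (not_lt.1 hk)]
    have h2 : IsEmpty (Fin (faceMasks k).length) := by
      rw [h1]
      exact Fin.isEmpty
    have h3 : IsEmpty (KW cs k) := ⟨fun σ => by
      have := (Finset.card_le_univ σ.1).trans_eq (Fintype.card_fin 6)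
      have := σ.2.1
      omega⟩
    exact ⟨Equiv.equivOfIsEmpty _ _, fun i => h2.elim i⟩

include hM in
lemma bcoeff_eq {k : ℕ} (hk : k < 7) (i : Fin (faceMasks k).length)
    (j : Fin (faceMasks (k + 1)).length) :
    bcoeff cs (face ((faceMasks (k + 1)).get j)) (face ((faceMasks k).get i)) =
      ev (entry (boundary k) i j) := by
  obtain ⟨h1, h2⟩ := boundary_spec k hk i j
  by_cases h : ∃ s ∈ face ((faceMasks (k + 1)).get j),
      face ((faceMasks k).get i) = (face ((faceMasks (k + 1)).get j)).erase s
  · obtain ⟨s, hs, hτ⟩ := h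
    obtain ⟨h3, h4⟩ := h1 s hs hτ
    have hk' : k + 1 < 7 := by
      by_contra hk'
      have h0 : faceMasks (k + 1) = [] := by
        rw [faceMasks, List.getD_eq_default _ _ (not_lt.1 hk')]
      exact absurd j.2 (by simp [h0])
    obtain ⟨l, hl⟩ := List.head?_eq_some_iff.1 h3
    have hne : toPoly (poinList ((faceMasks k).get i)) ≠ 0 := by
      rw [hl]
      exact toPoly_ne_zero one_ne_zero
    rw [bcoeff, Finset.sum_eq_single s, if_pos hτ,
      (poin_face cs hM ((faceMasks_spec _ hk).2 _ (List.get_mem _ _)).1).2,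
      (poin_face cs hM ((faceMasks_spec _ hk').2 _ (List.get_mem _ _)).1).2,
      toPoly_eq_of_eqL h4, toPoly_mulL, mul_div_cancel_right₀ _ hne, toPoly_smulL, map_mul,
      ← mul_assoc, ev]
    · simp only [Int.cast_pow, Int.cast_neg, Int.cast_one, map_pow, map_neg, map_one]
      rw [← mul_pow, neg_one_mul, neg_neg, one_pow, one_mul]
    · intro t ht hts
      refine if_neg fun h5 => hts ?_
      rw [hτ] at h5
      by_contra hne
      exact Finset.notMem_erase s _ (h5.symm ▸ Finset.mem_erase.2 ⟨Ne.symm hts, hs⟩)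
    · exact fun h => absurd hs h
  · push Not at h
    rw [h2 h, bcoeff, Finset.sum_eq_zero fun s hs => if_neg (h s hs)]
    simp [ev]

include hM in
/-- The homology of the weighted complex can be computed from the explicit matrices. -/
lemma nonempty_hgy_equiv {k : ℕ} (hk : k < 7) :
    Nonempty (Hgy cs k ≃ₗ[R] SeqHomology (boundaryMatrix k) (matrixCycles k)) := by
  choose e he using nonempty_face_equiv cs hM
  have hmat : ∀ k < 7, boundaryMatrix k =
      (Matrix.of fun (τ : KW cs k) (σ : KW cs (k + 1)) => bcoeff cs σ.1 τ.1).submatrix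
        (e k) (e (k + 1)) := by
    intro k hk
    ext i j
    rw [Matrix.submatrix_apply, Matrix.of_apply, he, he, bcoeff_eq cs hM hk]
    rfl
  have hcyc : matrixCycles k =
      (cycles cs k).map (LinearEquiv.funCongrLeft R R (e k) : _ →ₗ[R] _) := by
    cases k with
    | zero =>
      rw [matrixCycles, cycles, Submodule.map_top, LinearEquiv.range]
    | succ k =>
      rw [matrixCycles, cycles, hmat k (by omega), ker_submatrix_mulVecLin]
      rfl
  rw [hmat k hk]
  exact nonempty_seqHomology_reindex _ _ _ hcyc

end Complex

/-! ### Homology of the explicit matrices -/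

/-- A decidable criterion for the vanishing of `N` on the kernel of `B`, where `B` has `l` rows. -/
def vanishesOnKer (l : ℕ) (N B Q : List (List (List ℤ))) (d : List ℤ) : Bool :=
  d.headD 0 != 0 && Q.all (·.length ≤ l) && isZeroM (addM (smulM d N) (negM (mulM Q B)))

lemma mulVec_eq_zero_of_vanishesOnKer {l n : ℕ} {N B Q : List (List (List ℤ))} {d : List ℤ}
    (h : vanishesOnKer l N B Q d) {x : Fin n → R} (hx : (evM l n B).mulVec x = 0) :
    (evM n n N).mulVec x = 0 := by
  simp only [vanishesOnKer, Bool.and_eq_true, bne_iff_ne] at h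
  obtain ⟨⟨hd, hQ⟩, hz⟩ := h
  have hd' : ev d ≠ 0 := by
    cases d with
    | nil => exact absurd rfl hd
    | cons a l => exact ev_ne_zero hd
  refine mulVec_eq_zero_of_smul_eq_mul hd' (Q := evM n l Q) (B := evM l n B) ?_ hx
  rw [← evM_mulM hQ, ← evM_smulM, evM_eq_of_isZeroM hz]

/-- A decidable criterion for exactness. -/
def isExactM (l n m : ℕ) (A B H Q : List (List (List ℤ))) (u : ℤ) (d : List ℤ) : Bool :=
  u != 0 && A.all (·.length ≤ m) &&
    vanishesOnKer l (addM (scalarM n [u]) (negM (mulM A H))) B Q d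

lemma subsingleton_of_isExactM {l n m : ℕ} {A B H Q : List (List (List ℤ))} {u : ℤ} {d : List ℤ}
    (h : isExactM l n m A B H Q u d) :
    Subsingleton (SeqHomology (evM n m A) (LinearMap.ker (evM l n B).mulVecLin)) := by
  simp only [isExactM, Bool.and_eq_true, bne_iff_ne] at h
  obtain ⟨⟨hu, hA⟩, hz⟩ := h
  refine subsingleton_seqHomology (H := evM m n H) (isUnit_ev_singleton hu) fun x hx => ?_
  rw [← evM_scalarM, ← evM_mulM hA, sub_eq_add_neg, ← evM_negM, ← evM_addM]
  exact mulVec_eq_zero_of_vanishesOnKer hz hx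

/-- A decidable criterion for the homology to be cyclic with annihilator generated by `p`, apart
from a condition on the cycles. -/
def isCyclicM (n m : ℕ) (A z φ y ψ : List (List (List ℤ))) (u : ℤ) (p : List ℤ) : Bool :=
  u != 0 && A.all (·.length ≤ m) && z.all (·.length ≤ 1) && φ.all (·.length ≤ n) &&
    isZeroM (addM (mulM φ z) (negM (scalarM 1 [u]))) &&
    isZeroM (addM (mulM A y) (negM (smulM (mulL [u] p) z))) &&
    isZeroM (addM (mulM φ A) (negM (smulM p ψ)))

lemma nonempty_equiv_of_isCyclicM {n m : ℕ} {A H z φ y ψ : List (List (List ℤ))} {u : ℤ}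
    {p : List ℤ} {Z : Submodule R (Fin n → R)} (h : isCyclicM n m A z φ y ψ u p)
    (hz : ∀ c, (evM n 1 z).mulVec c ∈ Z)
    (hZ : ∀ x ∈ Z, (evM n n (addM (scalarM n [u])
      (negM (addM (mulM z φ) (mulM A H))))).mulVec x = 0) :
    Nonempty (SeqHomology (evM n m A) Z ≃ₗ[R] R ⧸ Ideal.span {ev p}) := by
  simp only [isCyclicM, Bool.and_eq_true, bne_iff_ne] at h
  obtain ⟨⟨⟨⟨⟨⟨hu, hA⟩, hz1⟩, hφ⟩, h1⟩, h2⟩, h3⟩ := h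
  refine nonempty_seqHomology_equiv (H := evM m n H) (z := evM n 1 z) (φ := evM 1 n φ)
    (y := evM m 1 y) (ψ := evM 1 m ψ) (isUnit_ev_singleton hu) (fun x hx => ?_) hz ?_ ?_ ?_
  · rw [← hZ x hx, evM_addM, evM_negM, evM_addM, evM_scalarM, evM_mulM hz1, evM_mulM hA,
      sub_sub, sub_eq_add_neg]
  · rw [← evM_mulM hφ, ← evM_scalarM, evM_eq_of_isZeroM h1]
  · rw [← evM_mulM hA, ← ev_mulL, ← evM_smulM, evM_eq_of_isZeroM h2]
  · rw [← evM_mulM hφ, ← evM_smulM, evM_eq_of_isZeroM h3]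

/-- Maps from degree `k` to degree `k + 1` that contract the complex up to torsion. -/
def homotopyTable : List (List (List (List ℤ))) :=
    [[], [[[], [0, -1], [0, -1], [0, -1, -1, -1], [0, -1, -2, -3, -2, -1], [0, -1, -3, -6, -7, -6,
    -3, -1]], [[], [1], [1], [1, 1, 1], [1, 2, 3, 2, 1], [1, 3, 6, 7, 6, 3, 1]], [[], [], [], [0,
    -1], [0, -1, -1, -1], [0, -1, -2, -3, -2, -1]], [[], [], [], [], [0, -1], [0, -1, -1, -1]],
    [[], [], [], [], [], [0, -1]], [[], [], [0, -1]], [[], [-1], [], [0, -1, -1], [0, -1, -2, -2,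
    -1], [0, -1, -3, -5, -5, -3, -1]], [], [], [[], [1], [], [1, 1, 1], [1, 2, 3, 2, 1], [1, 3, 6,
    7, 6, 3, 1]], [], [], [[], [], [], [], [1], [1, 1, 1]], [], [[], [], [], [], [], [1]]], [[[0,
    -2, -2], [], [], [], [], [2], [], [], [], [], [], [0, 2, 2]], [[2, 2, 2], [], [], [], [],
    [-2], [], [], [], [], [], [0, -2, -2]], [[1, -2, -1, -5, -5, -5, -2, -1], [], [1, -2, 0, -1],
    [1, -2, 0, -1], [1, -2, 0, -1], [-1, 1, 1, 3, 1, 1], [], [1, -2, 0, -1], [1, 0, 0, -1], [],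
    [1, -2, 0, -1], [1, -1, 0, 1, 4, 4, 2, 1], [], [1, 0, 0, -1]], [[-1, 0, 1, 5, 5, 5, 2, 1], [],
    [-1, 2, 0, 1], [-1, 2, 0, 1], [-1, 2, 0, 1], [1, -1, -1, -3, -1, -1], [], [-1, 2, 0, 1], [-1,
    0, 0, 1], [], [-1, 2, 0, 1], [-1, 1, 0, -1, -4, -4, -2, -1], [], [-1, 0, 0, 1]], [[-1, -2, -3,
    -2, -1], [], [-1], [-1], [-1], [1, 1, 1], [], [-1], [-1], [], [-1], [-1, 1, 2, 2, 1], [],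
    [-1]], [[0, -4, -6, -4, -2], [0, -2], [0, -2, -4, -4, -2], [0, 0, -2, -4, -2], [0, 0, -2, -4,
    -2], [0, 2, 4, 4, 2], [], [0, 2, 2], [0, 2, 2], [0, 0, -4, -6, -4, -2], [2, 0, -2, -4, -2],
    [0, 2, 0, -4, -2], [0, 2, 2, 2], [0, 2, 2]], [[-1, 2, 4, 4, 4, 2, 1], [], [-1, 0, 1], [-1, 0,
    1], [-1, 0, 1], [1, -1, -2, -1, -1], [], [1, 0, 1], [1, 0, 1], [0, -2], [-1, 0, 1], [1, -1,
    -1, -3, -3, -2, -1], [], [1, 0, 1]], [[0, 2, 2], [], [0, 2, 2], [-2, 2, 2], [-2, 2, 2], [0,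
    -2, -2], [], [-2], [-2], [0, 2, 2, 2], [-2, 2, 2], [-2, 2, 2], [0, -2], [-2]], [[1, 0, -1, -5,
    -5, -5, -2, -1], [], [1, -2, 0, -1], [1, -2, 0, -1], [1, -2, 0, -1], [-1, 1, 1, 3, 1, 1], [],
    [1, -2, 0, -1], [1, -2, 0, -1], [], [1, -2, 0, -1], [1, -3, 0, 1, 4, 4, 2, 1], [], [1, -2, 0,
    -1]], [[1, -2, -4, -4, -4, -2, -1], [], [1, 0, -1], [1, 0, -1], [-1, 0, -1], [-1, 1, 2, 1, 1],
    [], [-1, 0, -1], [-1, 0, -1], [0, 2], [1, 0, -1], [-1, 1, 1, 3, 3, 2, 1], [], [-1, 0, -1], [0,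
    -2]], [], [[0, 2, 2, 2], [], [], [], [], [0, -2], [], [], [], [], [], [0, 0, -2, -2]], [[],
    [], [], [], [], [], [], [], [], [], [], [0, -2]], [], [[], [], [0, 2, 2], [0, 2, 2], [0, 2,
    2], [0, -2, -2], [0, -2], [-2], [-2], [0, 2, 2, 2], [0, 2, 2], [0, 4, 4]], [[-1, 2, 4, 4, 4,
    2, 1], [], [-1, 0, 1], [-1, 0, 1], [-1, 0, 1], [1, -1, -2, -1, -1], [], [1, 0, 1], [-1, 0, 1],
    [0, -2], [-1, 0, 1], [-1, -1, -1, -3, -3, -2, -1], [], [-1, 0, 1]], [], [[-1, 2, 4, 4, 4, 2,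
    1], [], [-1, 0, 1], [-1, 0, 1], [-1, 0, 1], [1, -1, -2, -1, -1], [], [1, 0, 1], [1, 0, 1], [0,
    -2], [-1, 0, 1], [-1, -1, -1, -3, -3, -2, -1], [], [1, 0, 1]], [], []], [[[], [], [], [], [],
    [], [], [], [], [], [2]], [[], [], [2], [], [2, 4, 8, 12, 20, 22, 24, 20, 16, 8, 4], [0, 2],
    [], [], [], [], [2, 6, 14, 26, 46, 66, 86, 98, 102, 90, 72, 48, 28, 12, 4], [], [], [2, 0, 0,
    -2], [], [], [2, 0, 4, 2, 8, 4, 4]], [[], [], [-2, -2, -2], [0, -2, -2], [-2, -2, -8, -10,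
    -20, -22, -24, -20, -16, -8, -4], [], [0, 2], [], [], [], [-2, -6, -14, -28, -46, -68, -86,
    -98, -102, -90, -72, -48, -28, -12, -4], [2, 2, 2], [2, 2, 2], [-2, 2, 2, 6, 2, 2], [0, 2, 2,
    2], [], [-2, 0, -4, -2, -8, -4, -4]], [[], [], [], [], [0, -2, -4, -8, -12, -16, -18, -18,
    -16, -12, -8, -4, -2], [], [], [], [], [], [0, -2, -6, -14, -26, -42, -58, -72, -80, -80, -72,
    -58, -42, -26, -14, -6, -2], [], [], [0, -2, 0, -2], [], [], [0, -2, -2, -4, -4, -4, -4, -2,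
    -2]], [[], [], [2], [2], [0, 2, 4, 10, 16, 24, 30, 34, 34, 30, 24, 16, 10, 4, 2], [], [], [],
    [], [], [0, 4, 6, 20, 32, 58, 84, 114, 138, 152, 152, 138, 114, 84, 56, 32, 16, 6, 2], [-2],
    [-2], [0, 0, 0, 2, 0, 2], [0, -2], [], [0, 2, 2, 6, 6, 8, 8, 6, 6, 2, 2]], [[], [], [], [],
    [2, 2, 4, 2, 4, -2, -6, -14, -18, -22, -20, -16, -10, -4, -2], [], [], [], [], [0, 2], [2, 4,
    8, 10, 14, 10, 2, -16, -36, -62, -80, -90, -86, -72, -52, -32, -16, -6, -2], [], [], [2, 0, 0,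
    -4, 0, -2], [], [], [2, 0, 2, -2, 2, -4, -4, -6, -6, -2, -2], [], [], [0, 2, 0, 2]], [[], [],
    [], [], [-2], [], [], [], [], [], [-2, -2, -2, -2, -2]], [[], [], [], [], [0, 2, 0, 2], [],
    [], [], [], [], [0, 2, 2, 4, 4, 4, 2, 2]], [[], [], [], [], [-4, -4, -8, -12, -16, -16, -16,
    -12, -8, -4], [], [], [], [], [-2], [-4, -8, -16, -28, -44, -56, -68, -72, -68, -56, -40, -24,
    -12, -4], [], [], [-4], [], [], [-4, 0, -4, -4, -4, -4], [], [], [-2, 0, -2]], [[], [], [1, 1,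
    1], [1, 1, 1], [1, 2, 4, 9, 12, 16, 18, 18, 16, 12, 8, 4, 2], [], [], [], [1], [], [1, 4, 8,
    19, 30, 46, 60, 74, 80, 80, 72, 58, 42, 26, 14, 6, 2], [-1, -1, -1], [-1, -1, -1], [1, -1, -1,
    -1, -1, -1], [0, -1, -1, -1], [], [1, 0, 2, 3, 4, 4, 4, 2, 2], [], [], [1, -2, 0, -1]], [[],
    [], [], [], [0, -2, -4, -6, -6, -6, -4, -2], [], [], [], [], [], [0, -2, -6, -12, -18, -24,
    -26, -24, -18, -12, -6, -2], [], [], [], [], [], [0, -2, -2, -2]], [[], [], [], [], [0, 2, 4,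
    8, 12, 16, 18, 18, 16, 12, 8, 4, 2], [], [], [], [], [], [0, 4, 6, 16, 26, 42, 58, 72, 80, 80,
    72, 58, 42, 26, 14, 6, 2], [], [], [], [], [], [0, 2, 2, 4, 4, 4, 4, 2, 2]], [[], [], [2, 2,
    2], [0, 2, 2], [2, 2, 4, 2, 4, -2, -6, -14, -18, -22, -20, -16, -10, -4, -2], [], [], [], [],
    [], [2, 4, 8, 10, 14, 10, 2, -16, -36, -62, -80, -90, -86, -72, -52, -32, -16, -6, -2], [-2,
    -2, -2], [0, -2, -2], [2, -2, -2, -6, -2, -2], [0, -2, -2, -2], [], [2, 0, 2, -2, 2, -4, -4,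
    -6, -6, -2, -2], [], [0, -2]], [[], [], [], [], [], [], [], [], [], [], [], [], [], [-2]],
    [[], [], [], [], [-2, -2, -4, -6, -8, -8, -8, -6, -4, -2], [], [], [], [], [], [-2, -4, -8,
    -14, -22, -28, -34, -36, -34, -28, -20, -12, -6, -2], [], [], [], [], [], [-2, 0, -2, -2, -2,
    -2]]], [[], [[4, -8, 0, -8, 0, -4], [], [-4], [], [], [-3, 1, 0, -1, -5, -10, -16, -22, -29,
    -35, -39, -44, -45, -45, -41, -38, -30, -24, -17, -11, -6, -3, -1], [], [], [], [-2, -2, -8,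
    -10, -18, -24, -36, -44, -58, -70, -78, -88, -90, -90, -82, -76, -60, -48, -34, -22, -12, -6,
    -2], [2, 0, 2, 0, -2, -6, -8, -14, -18, -18, -22, -20, -18, -14, -12, -6, -4, -2], [], [-1,
    -1, 0, 1, 5, 10, 16, 22, 29, 35, 39, 44, 45, 45, 41, 38, 30, 24, 17, 11, 6, 3, 1], [1, -3, -4,
    -13, -17, -27, -29, -34, -32, -34, -29, -28, -23, -16, -6, 1, 14, 21, 28, 30, 32, 27, 23, 17,
    11, 6, 3, 1], [0, -2, -2, -10, -12, -26, -34, -54, -68, -94, -114, -136, -158, -168, -178,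
    -172, -166, -142, -124, -94, -70, -46, -28, -14, -6, -2]], [[], [], [], [], [], [6, -2, 0, 0,
    8, 14, 22, 32, 38, 44, 48, 50, 44, 44, 32, 26, 18, 12, 6, 4, 2], [], [], [0, 8], [4, 4, 16,
    16, 32, 36, 52, 64, 76, 88, 96, 100, 88, 88, 64, 52, 36, 24, 12, 8, 4], [-4, 0, -4, 4, 4, 12,
    20, 20, 24, 24, 20, 12, 16, 4, 4, 4], [], [2, 2, 0, 0, -8, -14, -22, -32, -38, -44, -48, -50,
    -44, -44, -32, -26, -18, -12, -6, -4, -2], [-2, 6, 8, 24, 32, 48, 48, 56, 46, 44, 34, 28, 12,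
    6, -12, -22, -32, -32, -38, -28, -24, -18, -12, -6, -4, -2], [0, 4, 4, 20, 20, 48, 52, 84,
    100, 128, 152, 172, 188, 184, 188, 152, 140, 100, 76, 48, 32, 16, 8, 4]], [[], [], [], [], [],
    [2, 0, -4, -2, -4, -6, -8, -8, -8, -12, -8, -10, -8, -6, -4, -4, -2], [], [], [], [-4, 0, -8,
    -4, -8, -12, -16, -16, -16, -24, -16, -20, -16, -12, -8, -8, -4], [4, -4, 0, 0, -4, -4, -4,
    -4, -8, 0, -4, -4], [], [-2, 0, 4, 2, 4, 6, 8, 8, 8, 12, 8, 10, 8, 6, 4, 4, 2], [2, -8, -4,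
    -10, -4, -8, -8, -4, -6, -8, -2, -2, 0, 2, 8, 4, 8, 8, 6, 4, 4, 2], [0, -4, 0, -12, -4, -16,
    -16, -24, -28, -32, -40, -32, -44, -32, -32, -24, -20, -12, -8, -4]], [[], [], [], [], [], [0,
    0, 2, 0, 2, 2, 0, 4, 4, 2, 2, 4, 2], [], [], [], [0, 0, 4, 0, 4, 4, 0, 8, 8, 4, 4, 8, 4], [0,
    0, -4, 4, 4, -4, 4, 4], [], [0, 0, -2, 0, -2, -2, 0, -4, -4, -2, -2, -4, -2], [0, 0, 2, 0, 2,
    2, 0, 2, 4, 0, 0, 4, -2, -4, -2, -2, -4, -2], [0, 0, 0, 4, 0, 8, 4, 4, 12, 8, 12, 12, 12, 8,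
    8, 4]], [[], [], [], [], [], [-2, 0, -2, 0, 0, -2, -4, -2], [], [], [], [-4, 0, -4, 0, 0, -4,
    -8, -4], [4, -4, -4], [], [2, 0, 2, 0, 0, 2, 4, 2], [-2, 0, -2, 0, 0, 0, -4, 0, 0, 0, 2, 4,
    2], [0, -4, 0, -8, 0, -4, -4, -8, -8, -8, -4]]]]

/-- Maps from degree `k - 1` to degree `k` that contract the complex up to torsion. -/
def cohomotopyTable : List (List (List (List ℤ))) :=
    [[], [[[1]], [], [], [], [], []], [[], [[], [2, 2, 4, 4, 2], [2], [2, 2, 4, 4, 2], [2, 0, 2,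
    4, 2], [2, 0, 2, 4, 2]], [[], [0, -2, -2, -2], [], [0, -2, -2, -2], [0, 0, -2, -2], [0, 0, -2,
    -2]], [[], [0, -2, -2, -4, -4, -2], [0, -2], [0, -2, -2, -4, -4, -2], [0, -2, 0, -2, -4, -2],
    [0, 0, 0, -2, -4, -2]], [[], [], [], [], [], [0, -2]], [], [[], [-2, -2, -2], [], [0, -2, -2],
    [0, -2, -2], [0, -2, -2]], [[], [0, 2], [], [0, 2], [0, 2], [0, 2]], [[], [0, 2, 2, 2], [],
    [0, 0, 2, 2], [0, 0, 2, 2], [0, 0, 2, 2]], [[], [2], [], [2], [2], [2]], [[], [0, 2, 4, 6, 4,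
    2], [0, 2], [0, 2, 4, 6, 4, 2], [0, 0, 2, 4, 4, 2], [0, 0, 2, 4, 4, 2]], [], [[], [0, -2, -2],
    [], [0, -2, -2], [2, -2, -2], [2, -2, -2]], [[], [0, -2, -2, -2], [], [0, 0, -2, -2], [0, 0,
    -2, -2], [0, 0, -2, -2]], [[], [], [], [], [], [2]]], [[[0, -2, 0, 4, 2], [0, 0, -2, -2], [0,
    -2, -2], [0, -2, 0, 4, 2], [0, -2, 0, 4, 2], [2, 0, -2, -4, -2], [0, 0, -2, -4, -4, -2], [0,
    -2, -2], [0, -2, -2], [], [0, 0, 2, 4, 2], [0, 0, 2, 4, 2], [0, 0, 2, 4, 4, 2], [0, 0, 2, 4,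
    2]], [[2, -2, -4, -4, -2], [], [0, 0, -2, -4, -2], [0, 0, -2, -4, -2], [0, 0, -2, -4, -2],
    [-2, 2, 4, 4, 2], [0, 0, 2, 2], [0, 2, 2], [0, 2, 2], [0, 0, -2, -4, -4, -2], [0, 0, -2, -4,
    -2], [0, 0, -2, -4, -2]], [[0, 0, 4, 8, 10, 10, 6, 2], [0, 0, 2, 2, 2], [0, 0, 4, 8, 10, 10,
    6, 2], [0, 0, 2, 4, 6, 8, 6, 2], [0, -2, 0, 2, 6, 8, 6, 2], [0, 0, -2, -6, -10, -10, -6, -2],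
    [], [0, -2, -2, -4, -4, -2], [0, -2, -4, -6, -4, -2], [0, 0, 2, 6, 12, 14, 12, 6, 2], [0, -2,
    0, 2, 6, 8, 6, 2], [0, -2, -2, 0, 6, 8, 6, 2], [0, 0, -2, -4, -6, -4, -2], [0, -2, -4, -6, -4,
    -2], [0, 0, -2, -2, -2]], [[0, 2, 0, -4, -10, -10, -6, -2], [], [0, 2, 0, -2, -6, -8, -6, -2],
    [0, 2, 0, -2, -6, -8, -6, -2], [0, 4, 2, 0, -6, -8, -6, -2], [0, -2, 0, 4, 10, 10, 6, 2], [0,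
    0, 0, 2, 4, 4, 2], [0, 2, 2, 4, 4, 2], [0, 2, 4, 6, 4, 2], [0, 0, 0, -2, -6, -10, -10, -6,
    -2], [0, 2, 0, -2, -6, -8, -6, -2], [0, 2, 2, 0, -6, -8, -6, -2], [], [0, 2, 2, 2], [0, 0, 2,
    2, 2]], [], [[0, -4, -8, -10, -10, -6, -2], [0, -2, -2, -2], [0, -4, -8, -10, -10, -6, -2],
    [0, -2, -4, -6, -8, -6, -2], [2, 0, -2, -6, -8, -6, -2], [0, 2, 6, 10, 10, 6, 2], [], [2, 2,
    4, 4, 2], [2, 4, 6, 4, 2], [0, -2, -6, -12, -14, -12, -6, -2], [2, 0, -2, -6, -8, -6, -2], [2,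
    2, 0, -6, -8, -6, -2], [0, 2, 4, 6, 4, 2], [2, 4, 6, 4, 2], [0, 2, 2, 2]], [[-2, 0, 4, 10, 10,
    6, 2], [], [-2, 0, 2, 6, 8, 6, 2], [-2, 0, 2, 6, 8, 6, 2], [-4, -2, 0, 6, 8, 6, 2], [2, 0, -4,
    -10, -10, -6, -2], [0, 0, -2, -4, -4, -2], [-2, -2, -4, -4, -2], [-2, -4, -6, -4, -2], [0, 0,
    2, 6, 10, 10, 6, 2], [-2, 0, 2, 6, 8, 6, 2], [-2, -2, 0, 6, 8, 6, 2], [], [-2, -2, -2], [0,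
    -2, -2, -2]], [[1, 2, 1, -5, -7, -8, -6, -3, -1], [], [1, 2, 2, -3, -5, -6, -5, -3, -1], [-1,
    2, 2, -3, -5, -6, -5, -3, -1], [-1, 2, 2, -3, -5, -6, -5, -3, -1], [-1, -2, -1, 5, 7, 8, 6, 3,
    1], [0, 0, 1, 2, 3, 3, 2, 1], [-1, 1, 3, 3, 3, 2, 1], [-1, 1, 3, 3, 3, 2, 1], [0, 2, 1, -1,
    -6, -8, -8, -6, -3, -1], [-1, 2, 2, -3, -5, -6, -5, -3, -1], [-1, 2, 2, -3, -5, -6, -5, -3,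
    -1], [0, -2], [-1, 0, 1]], [[1, -2, -2, -2, 5, 9, 10, 7, 3, 1], [], [1, -2, -1, -2, 2, 6, 8,
    6, 3, 1], [1, -2, -1, -2, 2, 6, 8, 6, 3, 1], [1, -2, -1, -2, 2, 6, 8, 6, 3, 1], [-1, 2, 2, 2,
    -5, -9, -10, -7, -3, -1], [0, 0, 1, 0, -2, -4, -4, -2, -1], [1, -1, 0, -3, -4, -4, -2, -1],
    [1, -1, 0, -3, -4, -4, -2, -1], [0, 0, -1, -1, 1, 6, 10, 10, 7, 3, 1], [1, -2, -1, -2, 2, 6,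
    8, 6, 3, 1], [1, -2, -1, -2, 2, 6, 8, 6, 3, 1], [], [1, -2, 0, -1]], [[1, 0, -1, -5, -7, -8,
    -6, -3, -1], [], [1, 0, 0, -3, -5, -6, -5, -3, -1], [1, 0, 0, -3, -5, -6, -5, -3, -1], [1, 0,
    0, -3, -5, -6, -5, -3, -1], [-1, 0, 1, 5, 7, 8, 6, 3, 1], [0, 0, 1, 2, 3, 3, 2, 1], [1, 1, 3,
    3, 3, 2, 1], [1, 1, 3, 3, 3, 2, 1], [0, 0, -1, -3, -6, -8, -8, -6, -3, -1], [1, 0, 0, -3, -5,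
    -6, -5, -3, -1], [1, 0, 0, -3, -5, -6, -5, -3, -1], [], [1, 0, 1]], [], [[0, 0, -2, -4, -4,
    -2], [0, 0, 2, 2, 2], [], [0, 0, -2, -4, -4, -2], [0, 0, -2, -4, -4, -2], [0, 0, 4, 6, 4, 2],
    [0, 0, 2, 4, 6, 4, 2], [0, 2, 2, 2], [0, 2, 2, 2], [0, 0, -2, -2, -2], [0, -2, -4, -6, -4,
    -2], [0, 0, -4, -6, -4, -2], [0, 0, -2, -4, -6, -4, -2], [0, 0, -2, -4, -4, -2]], [[0, 2, 2,
    2], [], [0, 2, 2, 2], [0, 2, 2, 2], [0, 2, 2, 2], [0, -2, -2, -2], [], [], [], [0, 0, 2, 2,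
    2], [0, 2, 2, 2], [0, 0, 2, 2]], [], [[0, 4, 6, 4, 2], [], [0, 2, 4, 4, 2], [0, 2, 4, 4, 2],
    [0, 2, 4, 4, 2], [0, -4, -6, -4, -2], [0, -2, -2, -2], [-2, -2, -2], [-2, -2, -2], [0, 2, 4,
    6, 4, 2], [0, 2, 4, 4, 2], [0, 2, 4, 4, 2]], [[0, -2, -6, -10, -10, -6, -2], [], [0, -2, -4,
    -6, -8, -6, -2], [0, -2, -4, -6, -8, -6, -2], [0, 0, -2, -6, -8, -6, -2], [0, 2, 6, 10, 10, 6,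
    2], [0, 0, 2, 4, 4, 2], [2, 2, 4, 4, 2], [0, 4, 6, 4, 2], [0, -2, -4, -8, -10, -10, -6, -2],
    [0, -2, -4, -6, -8, -6, -2], [0, 0, -2, -6, -8, -6, -2], [], [0, 2, 2], [0, 0, 2, 2]], [],
    [[-2], [], [-2], [-2], [-2], [2], [], [], [], [0, -2], [-2], [-2]], [[0, 2, 6, 10, 10, 6, 2],
    [], [0, 2, 4, 6, 8, 6, 2], [0, 2, 4, 6, 8, 6, 2], [-2, 0, 2, 6, 8, 6, 2], [0, -2, -6, -10,
    -10, -6, -2], [0, 0, -2, -4, -4, -2], [-2, -2, -4, -4, -2], [-2, -4, -6, -4, -2], [0, 2, 4, 8,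
    10, 10, 6, 2], [0, 2, 4, 6, 8, 6, 2], [-2, 0, 2, 6, 8, 6, 2], [], [-2, -2, -2], [0, -2, -2,
    -2]], [[-1, 0, 2, 5, 5, 3, 1], [], [-1, 0, 1, 3, 4, 3, 1], [-1, 0, 1, 3, 4, 3, 1], [-1, 0, 1,
    3, 4, 3, 1], [1, 0, -2, -5, -5, -3, -1], [0, 0, -1, -2, -2, -1], [-1, -1, -2, -2, -1], [-1,
    -1, -2, -2, -1], [0, 0, 1, 3, 5, 5, 3, 1], [-1, 0, 1, 3, 4, 3, 1], [-1, 0, 1, 3, 4, 3, 1], [],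
    [-1]]], [[[], [], [-2, -2, 4, 14, 22, 22, 18, 12, 6, 2], [0, -2, -2, 6, 14, 16, 14, 10, 6, 2],
    [0, 4, 4, 4, 4], [], [0, 4, 4], [], [], [0, 2, 0, -6, -8, -8, -6, -4, -2], [4, 4, 8, 4, 4],
    [2, 2, -4, -14, -22, -22, -18, -12, -6, -2], [4, 6, 2, -6, -14, -16, -14, -10, -6, -2], [2, 2,
    0, -12, -28, -46, -56, -54, -44, -28, -16, -6, -2], [0, 2, 2, -4, -14, -22, -22, -18, -12, -6,
    -2], [], [0, 2, 2, -2, -4, -8, -14, -14, -18, -22, -22, -22, -20, -16, -10, -6, -2], [], [0,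
    -2, -4, -6, -8, -8, -6, -4, -2], [0, 2, 0, -4, -8, -14, -14, -12, -8, -4, -2]], [[], [], [4,
    -12, -28, -44, -60, -64, -60, -44, -28, -12, -4], [0, -8, -20, -36, -52, -60, -56, -44, -28,
    -12, -4], [0, 4, 8, 20, 28, 40, 40, 40, 28, 20, 8, 4], [0, 8], [], [], [0, -4, -8, -12, -16,
    -16, -12, -8, -4], [0, 4, 4, 8, 8, 8, 4, 4], [0, 4, 8, 20, 28, 40, 40, 40, 28, 20, 8, 4], [4,
    12, 28, 44, 60, 64, 60, 44, 28, 12, 4], [0, 8, 20, 36, 52, 60, 56, 44, 28, 12, 4], [-4, 12,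
    20, 72, 96, 156, 160, 176, 140, 112, 64, 36, 12, 4], [0, 4, 12, 28, 44, 60, 64, 60, 44, 28,
    12, 4], [], [0, 0, 4, 20, 32, 56, 68, 72, 72, 56, 44, 28, 20, 12, 8, 4], [], [0, 4, 4, 8, 8,
    8, 4, 4], [0, 0, 4, 16, 24, 40, 44, 44, 32, 24, 8, 4]], [[], [], [-2, 6, 20, 34, 34, 16, -8,
    -36, -52, -56, -46, -30, -16, -6, -2], [0, 2, 14, 34, 42, 36, 16, -8, -28, -40, -36, -26, -14,
    -6, -2], [0, 0, -12, -24, -40, -56, -52, -52, -32, -24, -8, -4], [], [0, 4, -4, -8, -8, -8,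
    -4, -4], [], [0, 4, 8, 12, 16, 16, 12, 8, 4], [0, -6, -4, -6, 0, 8, 20, 24, 28, 24, 16, 10, 4,
    2], [4, -8, -8, -40, -40, -68, -52, -56, -32, -24, -8, -4], [2, -6, -20, -34, -34, -16, 8, 36,
    52, 56, 46, 30, 16, 6, 2], [4, -6, -22, -42, -50, -40, -20, 8, 28, 40, 36, 26, 14, 6, 2], [2,
    -6, -16, -48, -64, -80, -50, -6, 60, 112, 138, 138, 108, 76, 40, 20, 6, 2], [0, 2, -6, -20,
    -34, -34, -16, 8, 36, 52, 56, 46, 30, 16, 6, 2], [], [0, -2, -6, -22, -32, -48, -48, -40, -20,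
    10, 38, 64, 82, 86, 88, 76, 64, 44, 28, 14, 6, 2], [], [0, -2, 0, 2, 8, 16, 24, 28, 28, 24,
    16, 10, 4, 2], [0, -2, -4, -16, -16, -22, -12, 0, 20, 28, 36, 30, 20, 12, 4, 2]], [[], [], [4,
    8, 12, 12, 12, 8, 4], [0, 4, 8, 8, 8, 8, 4], [], [], [], [], [], [0, -4, -4, -4, -4, -4], [],
    [-4, -8, -12, -12, -12, -8, -4], [0, -4, -8, -8, -8, -8, -4], [4, -16, -12, -32, -28, -36,
    -24, -20, -8, -4], [0, -4, -8, -12, -12, -12, -8, -4], [], [0, -4, 0, -8, -4, -4, -12, -8,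
    -12, -12, -12, -8, -8, -4], [], [0, -4, -4, -4, -4, -4], [0, -4, -4, -8, -8, -8, -4, -4]],
    [[], [], [2, -10, -16, -10, 2, 28, 52, 72, 76, 68, 50, 30, 16, 6, 2], [8, -6, -10, -10, -6, 8,
    28, 44, 52, 52, 40, 26, 14, 6, 2], [0, 4, 4, 12, 12, 16, 12, 12, 4, 4], [], [0, 4, 4, 8, 8, 8,
    4, 4], [], [], [0, 6, 4, 6, 0, -8, -20, -24, -28, -24, -16, -10, -4, -2], [-4, 12, 0, 28, 12,
    28, 12, 16, 4, 4], [-2, 10, 16, 10, -2, -28, -52, -72, -76, -68, -50, -30, -16, -6, -2], [-4,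
    10, 18, 18, 14, -4, -24, -44, -52, -52, -40, -26, -14, -6, -2], [-2, 10, 12, 32, 16, 0, -58,
    -114, -168, -200, -194, -170, -120, -80, -40, -20, -6, -2], [0, -2, 10, 16, 10, -2, -28, -52,
    -72, -76, -68, -50, -30, -16, -6, -2], [], [0, 6, 2, 14, 4, 4, -4, -20, -28, -46, -58, -72,
    -82, -86, -88, -76, -64, -44, -28, -14, -6, -2], [], [0, 2, 0, -2, -8, -16, -24, -28, -28,
    -24, -16, -10, -4, -2], [0, 6, 4, 12, 4, -2, -20, -32, -48, -48, -44, -34, -20, -12, -4, -2]],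
    [[], [], [0, -4, -12, -24, -36, -44, -44, -36, -24, -12, -4], [0, -4, -12, -24, -36, -44, -44,
    -36, -24, -12, -4], [0, 4, 8, 20, 28, 40, 40, 40, 28, 20, 8, 4], [], [], [], [0, -4, -8, -12,
    -16, -16, -12, -8, -4], [0, 8], [0, 4, 8, 20, 28, 40, 40, 40, 28, 20, 8, 4], [0, 4, 12, 24,
    36, 44, 44, 36, 24, 12, 4], [0, 4, 12, 24, 36, 44, 44, 36, 24, 12, 4], [0, 4, 12, 32, 56, 88,
    108, 120, 108, 88, 56, 32, 12, 4], [0, 0, 4, 12, 24, 36, 44, 44, 36, 24, 12, 4], [], [0, 4, 4,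
    16, 28, 44, 52, 60, 48, 36, 20, 8], [], [], [0, 4, 0, 12, 12, 24, 32, 32, 28, 20, 8, 4]], [[],
    [], [], [4, 4], [-4, -4, -8, -4, -4], [], [], [], [4, 4], [0, 4, 4], [-4, -4, -8, -4, -4], [],
    [-4, -4], [], [], [], [4, -4, -8, -8, -4, 4, 4, 4, 4, 8, 4], [], [0, 4, 4], [4, 0, -4]], [[],
    [], [2, 2, -2, -12, -24, -36, -44, -44, -36, -24, -14, -6, -2], [-4, -2, -2, -8, -16, -20,
    -28, -32, -28, -20, -12, -6, -2], [-4, 8, 0, 8, 0, 4], [], [0, -4, -4, -4, -4, -4], [], [-4,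
    -4, -4, -4, -4], [0, -6, -4, 0, 4, 8, 16, 16, 12, 8, 4, 2], [], [-2, -2, 2, 12, 24, 36, 44,
    44, 36, 24, 14, 6, 2], [0, -2, -2, 4, 12, 20, 28, 32, 28, 20, 12, 6, 2], [-2, -2, -2, 10, 26,
    58, 84, 112, 116, 112, 86, 62, 34, 18, 6, 2], [0, -2, -2, 2, 12, 24, 36, 44, 44, 36, 24, 14,
    6, 2], [], [-4, 2, 2, 12, 10, 20, 18, 24, 22, 30, 36, 42, 46, 44, 42, 32, 22, 12, 6, 2], [],
    [0, -2, 0, 4, 8, 12, 16, 16, 12, 8, 4, 2], [-4, -2, 0, 2, 8, 20, 24, 28, 28, 24, 16, 10, 4,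
    2]], [[], [], [4, 12, 24, 36, 44, 44, 36, 24, 12, 4], [4, 12, 24, 36, 44, 44, 36, 24, 12, 4],
    [-4, -8, -20, -28, -40, -40, -40, -28, -20, -8, -4], [], [], [], [4, 8, 12, 16, 16, 12, 8, 4],
    [-8], [-4, -8, -20, -28, -40, -40, -40, -28, -20, -8, -4], [-4, -12, -24, -36, -44, -44, -36,
    -24, -12, -4], [-4, -12, -24, -36, -44, -44, -36, -24, -12, -4], [-4, -12, -32, -56, -88,
    -108, -120, -108, -88, -56, -32, -12, -4], [0, -4, -12, -24, -36, -44, -44, -36, -24, -12,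
    -4], [], [-4, -4, -16, -28, -44, -52, -60, -48, -36, -20, -8], [], [], [-4, 0, -12, -12, -24,
    -32, -32, -28, -20, -8, -4]], [[], [], [0, -4, -8, -12, -12, -8, -4], [0, -4, -8, -12, -12,
    -8, -4], [0, 4, 4, 12, 8, 12, 4, 4], [], [], [], [0, -4, -4, -4, -4], [], [0, 4, 4, 12, 8, 12,
    4, 4], [0, 4, 8, 12, 12, 8, 4], [0, 4, 8, 12, 12, 8, 4], [0, 4, 8, 20, 24, 32, 24, 20, 8, 4],
    [0, 0, 4, 8, 12, 12, 8, 4], [], [0, 0, 4, 16, 12, 16, 12, 8], [], [], [0, -4, 4, 4, 8, 12, 4,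
    4]], [[], [], [], [], [], [], [], [], [], [], [], [], [], [], [], [], [0, -4, 0, -4, 0, 0, -4,
    -8, -4]], [[], [], [-2, -2, 2, 12, 24, 36, 44, 44, 36, 24, 14, 6, 2], [0, -2, -2, 4, 12, 20,
    28, 32, 28, 20, 12, 6, 2], [0, 4, 4, 8, 8, 8, 4, 4], [], [0, 4, 4, 4, 4, 4], [], [], [0, 2, 0,
    -4, -8, -12, -16, -16, -12, -8, -4, -2], [-4, 12, 4, 16, 8, 12, 4, 4], [2, 2, -2, -12, -24,
    -36, -44, -44, -36, -24, -14, -6, -2], [4, 6, 6, 0, -8, -20, -28, -32, -28, -20, -12, -6, -2],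
    [2, 2, 2, -10, -26, -58, -84, -112, -116, -112, -86, -62, -34, -18, -6, -2], [0, 2, 2, -2,
    -12, -24, -36, -44, -44, -36, -24, -14, -6, -2], [], [0, 6, 2, 8, 2, -4, -6, -16, -22, -30,
    -36, -42, -46, -44, -42, -32, -22, -12, -6, -2], [], [0, -2, -4, -8, -12, -16, -16, -16, -12,
    -8, -4, -2], [0, 2, 0, -2, -8, -16, -24, -28, -28, -24, -16, -10, -4, -2]], [[], [], [4, -4,
    -20, -44, -60, -64, -60, -44, -28, -12, -4], [0, 0, -12, -36, -52, -60, -56, -44, -28, -12,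
    -4], [0, 4, 8, 20, 28, 40, 40, 40, 28, 20, 8, 4], [], [], [], [0, -4, -8, -12, -16, -16, -12,
    -8, -4], [0, 4, 4, 8, 8, 8, 4, 4], [0, 4, 8, 20, 28, 40, 40, 40, 28, 20, 8, 4], [-4, 4, 20,
    44, 60, 64, 60, 44, 28, 12, 4], [0, 0, 12, 36, 52, 60, 56, 44, 28, 12, 4], [-4, 4, 12, 56, 88,
    148, 160, 176, 140, 112, 64, 36, 12, 4], [0, -4, 4, 20, 44, 60, 64, 60, 44, 28, 12, 4], [],
    [0, 4, 4, 16, 28, 44, 52, 60, 48, 36, 20, 8], [], [0, -4, 4, 8, 8, 8, 4, 4], [0, 0, 4, 16, 24,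
    40, 44, 44, 32, 24, 8, 4]], [[], [], [4, 8, 8, 4], [0, 4, 8, 4], [], [], [], [], [], [0, -4,
    -4], [], [-4, -8, -8, -4], [0, -4, -8, -4], [-4, -8, -16, -16, -16, -8, -4], [0, -4, -8, -8,
    -4], [], [], [], [0, -4, -4], [0, -4, -4, -4, -4]], [[], [], [], [4, 4], [-4, -4, -8, -4, -4],
    [], [], [], [4, 4], [0, 4, 4], [-4, -4, -8, -4, -4], [], [-4, -4], [], [], [], [-4, 0, -8,
    -12, -8], [], [0, 4, 4], [4, 0, -4]]], [[[], [], [], [], [], [-1, 0, 0, 1, -1, 1, 2, 1, 1, 1,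
    2, 0, 1], [0, 2, -3, 3, -3, 1, 2, 6, 7, 13, 19, 21, 23, 25, 25, 21, 18, 14, 9, 5, 3, 1], [],
    [0, -2, 0, -2, 0, -4, 0, -2, 0, -2], [0, -2, -2, -4, -6, -8, -8, -10, -10, -8, -8, -6, -4, -2,
    -2], [4, -6, 5, -1, -1, 0, 2, 5, 8, 16, 20, 27, 33, 37, 37, 36, 34, 28, 21, 16, 10, 5, 3, 1],
    [], [-1, 0, -2, -1, -3, -1, -4, -1, -3, -1, -2, 0, -1], [1, -2, 0, -7, -5, -18, -12, -29, -20,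
    -34, -21, -32, -16, -21, -9, -10, -2, -3], [0, -2, 1, -5, -3, -9, -14, -20, -25, -31, -37,
    -39, -37, -37, -33, -27, -20, -16, -9, -5, -3, -1]], [[2, -6, 6, -8, 6, -12, 8, -10, 4, -6, 2,
    -2], [], [-2, 2, -2, 0, -2, 2, -2], [], [], [0, 2, 1, 1, 3, 2, 1, 0, -1, -3, -5, -5, -9, -6,
    -7, -7, -5, -4, -2, -3, 0, -1], [0, -1, 3, -1, 6, 5, 7, 9, 7, 6, -9, -11, -34, -50, -71, -90,
    -108, -122, -123, -127, -118, -104, -87, -71, -51, -35, -23, -13, -6, -3, -1], [], [0, 2, 0,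
    4, 2, 8, 4, 10, 8, 10, 10, 8, 10, 4, 8, 2, 4, 0, 2], [0, 2, 2, 6, 10, 16, 22, 32, 40, 46, 56,
    58, 60, 58, 56, 46, 40, 32, 22, 16, 10, 6, 2, 2], [-2, 5, -3, 5, 7, 7, 14, 11, 20, 4, 9, -11,
    -31, -52, -84, -109, -147, -163, -185, -195, -191, -181, -164, -139, -110, -86, -61, -39, -25,
    -14, -6, -3, -1], [], [0, 0, 1, 1, 3, 4, 7, 8, 11, 13, 13, 15, 13, 14, 9, 11, 5, 6, 2, 3, 0,
    1], [0, 0, 1, 3, 7, 16, 25, 45, 62, 88, 111, 136, 155, 165, 178, 162, 164, 131, 124, 82, 77,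
    40, 36, 14, 13, 2, 3], [0, 1, -1, 3, 2, 7, 15, 23, 41, 56, 87, 107, 138, 166, 187, 206, 212,
    218, 201, 189, 166, 136, 109, 83, 59, 37, 25, 13, 6, 3, 1]], [[], [], [], [], [], [1, -2, -2,
    -1, -1, -4, -4, 5, 1, 4, 13, 15, 17, 21, 27, 19, 24, 21, 15, 14, 10, 7, 3, 4, 0, 1], [0, 0, 1,
    -1, -3, -3, -8, -13, -8, -2, 7, 40, 82, 127, 196, 271, 333, 397, 454, 475, 481, 471, 430, 375,
    318, 252, 187, 136, 90, 55, 32, 17, 7, 3, 1], [], [0, 2, -4, -2, -4, -8, -14, -18, -18, -28,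
    -28, -30, -30, -28, -28, -18, -22, -10, -12, -4, -6, 0, -2], [0, 2, -2, -4, -6, -20, -34, -48,
    -74, -104, -122, -150, -176, -180, -188, -188, -172, -150, -134, -104, -78, -60, -38, -24,
    -14, -8, -2, -2], [0, 0, 1, -1, -3, -2, -10, -14, -9, -11, 1, 38, 77, 135, 231, 322, 418, 536,
    624, 686, 740, 750, 716, 672, 597, 497, 407, 314, 225, 157, 103, 60, 34, 18, 7, 3, 1], [], [1,
    -2, 0, -3, -7, -10, -14, -23, -29, -32, -43, -45, -45, -49, -45, -41, -34, -33, -19, -20, -10,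
    -9, -3, -4, 0, -1], [-1, 4, -2, 3, -5, -11, -38, -59, -108, -169, -229, -309, -386, -454,
    -505, -546, -559, -530, -516, -437, -391, -295, -252, -157, -130, -67, -51, -19, -16, -2, -3],
    [0, 0, 1, -1, 1, -5, -16, -27, -60, -106, -159, -236, -336, -425, -526, -635, -701, -757,
    -792, -781, -735, -683, -594, -491, -402, -304, -219, -152, -100, -57, -34, -17, -7, -3, -1]],
    [[], [], [], [], [], [3, -2, 3, 0, 4, -3, 1, -1, -4, -4, -7, -5, -10, -6, -7, -7, -5, -4, -2,
    -3, 0, -1], [0, 0, 1, 1, 2, 3, 3, 0, -3, -11, -25, -40, -60, -84, -107, -125, -144, -153,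
    -153, -148, -136, -116, -95, -75, -53, -36, -23, -13, -6, -3, -1], [], [0, 2, 0, 4, 2, 8, 4,
    10, 8, 10, 10, 8, 10, 4, 8, 2, 4, 0, 2], [0, 2, 2, 6, 10, 16, 22, 32, 40, 46, 56, 58, 60, 58,
    56, 46, 40, 32, 22, 16, 10, 6, 2, 2], [0, 0, 1, 1, 2, 4, 3, 2, -1, -10, -25, -42, -69, -102,
    -132, -167, -199, -220, -233, -239, -228, -208, -185, -152, -119, -90, -63, -40, -25, -14, -6,
    -3, -1], [], [-1, 2, 1, 2, 4, 7, 9, 9, 14, 14, 15, 15, 14, 14, 9, 11, 5, 6, 2, 3, 0, 1], [1,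
    -4, 5, 0, 12, 14, 33, 50, 68, 98, 116, 148, 157, 174, 179, 166, 164, 132, 124, 82, 77, 40, 36,
    14, 13, 2, 3], [0, 0, 1, 1, 6, 9, 19, 32, 51, 73, 103, 136, 164, 200, 223, 241, 248, 249, 231,
    210, 184, 148, 117, 87, 61, 38, 25, 13, 6, 3, 1]], [[], [], [], [], [], [-3, 2, 0, -2, -1, 3,
    0, 0, 5, 1, 2, 4, 3, 1, 2, 2, 0, 1], [0, -2, 1, 1, -3, -2, 5, 1, 3, 16, 21, 23, 38, 47, 48,
    55, 58, 51, 47, 42, 31, 23, 17, 10, 5, 3, 1], [], [0, -2, 0, -2, -2, -4, -2, -4, -4, -2, -4,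
    -2, -2, 0, -2], [-4, 2, -2, -8, -8, -6, -16, -18, -16, -22, -24, -18, -20, -18, -12, -10, -8,
    -4, -2, -2], [0, -2, 1, 1, -5, 1, 3, -2, 7, 17, 17, 31, 51, 54, 66, 84, 82, 82, 85, 73, 61,
    53, 39, 26, 19, 11, 5, 3, 1], [], [1, -2, -2, 0, -3, -5, -4, -4, -7, -5, -4, -6, -3, -3, -2,
    -2, 0, -1], [-1, 0, 0, -8, -7, -14, -22, -36, -35, -52, -59, -60, -63, -62, -57, -44, -44,
    -26, -23, -12, -10, -2, -3], [0, -2, 1, -7, -3, -8, -19, -25, -27, -48, -61, -63, -78, -91,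
    -84, -87, -86, -71, -61, -52, -37, -25, -19, -10, -5, -3, -1]], [[], [], [], [], [], [1, 0, 0,
    -1, 1, -1, -2, -1, -1, -1, -2, 0, -1], [0, 0, 1, 1, 1, 1, 0, -4, -7, -11, -17, -21, -23, -25,
    -25, -21, -18, -14, -9, -5, -3, -1], [], [0, 2, 0, 2, 0, 4, 0, 2, 0, 2], [0, 2, 2, 4, 6, 8, 8,
    10, 10, 8, 8, 6, 4, 2, 2], [0, 0, 1, 1, 1, 2, 0, -3, -6, -12, -20, -25, -31, -37, -37, -36,
    -34, -28, -21, -16, -10, -5, -3, -1], [], [1, 0, 2, 1, 3, 1, 4, 1, 3, 1, 2, 0, 1], [-1, 2, 0,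
    7, 5, 18, 12, 29, 20, 34, 21, 32, 16, 21, 9, 10, 2, 3], [0, 0, 1, 1, 5, 7, 12, 18, 25, 29, 35,
    39, 37, 37, 33, 27, 20, 16, 9, 5, 3, 1]]]]

/-- A map from degree `k` to degree `k + 1` that contracts the complex up to torsion. -/
def homotopy (k : ℕ) : List (List (List ℤ)) := homotopyTable.getD k []

/-- A map from degree `k - 1` to degree `k` that contracts the complex up to torsion. -/
def cohomotopy (k : ℕ) : List (List (List ℤ)) := cohomotopyTable.getD k []

lemma nonempty_matrixHomology_zero :
    Nonempty (SeqHomology (boundaryMatrix 0) (matrixCycles 0) ≃ₗ[R] CycQuot 2) := by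
  change Nonempty (_ ≃ₗ[R] R ⧸ Ideal.span {cyc 2})
  rw [← ev_eq_cyc_two]
  refine nonempty_equiv_of_isCyclicM (H := []) (z := [[[1]]]) (φ := [[[1]]])
    (y := [[[1]], [], [], [], [], []]) (ψ := [[[1], [1], [1], [1], [1], [1]]]) (u := 1)
    (by decide +kernel) (fun _ => trivial) fun x _ => ?_
  rw [evM_eq_zero (by decide +kernel), Matrix.zero_mulVec]

lemma subsingleton_matrixHomology_one :
    Subsingleton (SeqHomology (boundaryMatrix 1) (matrixCycles 1)) :=
  subsingleton_of_isExactM (H := homotopy 1) (Q := cohomotopy 1) (u := 1) (d := [1, 1])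
    (by decide +kernel)

lemma subsingleton_matrixHomology_two :
    Subsingleton (SeqHomology (boundaryMatrix 2) (matrixCycles 2)) :=
  subsingleton_of_isExactM (H := homotopy 2) (Q := cohomotopy 2) (u := 2) (d := [1])
    (by decide +kernel)

lemma subsingleton_matrixHomology_three :
    Subsingleton (SeqHomology (boundaryMatrix 3) (matrixCycles 3)) :=
  subsingleton_of_isExactM (H := homotopy 3) (Q := cohomotopy 3) (u := 2) (d := [1])
    (by decide +kernel)

/-- A generator of the homology in degree `4`. -/
def cycleFour : List (List (List ℤ)) :=
    [[[1, 2, 5, 9, 13, 19, 25, 31, 38, 45, 49, 52, 51, 45, 37, 27, 17, 9, 4, 1]], [[-2, 0, -4, -6,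
    -14, -26, -44, -62, -78, -88, -86, -80, -64, -50, -34, -22, -12, -6, -2]], [[1, -2, -3, -7,
    -11, -14, -17, -22, -35, -54, -86, -121, -158, -185, -200, -198, -179, -150, -113, -78, -47,
    -25, -11, -4, -1]], [[2, 2, 6, 8, 10, 14, 18, 20, 24, 28, 26, 26, 22, 16, 10, 6, 2]], [[-1, 0,
    -1, 3, 9, 18, 33, 50, 71, 94, 122, 147, 174, 193, 202, 198, 179, 150, 113, 78, 47, 25, 11, 4,
    1]], [[0, 2, 4, 4, 2, -4, -16, -28, -36, -40, -36, -26, -16, -8, -2]], [[-4, -4, -2, -2, 0,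
    -2, -4, -8, -12, -12, -10, -8, -6, -2]], [[3, 2, 0, -5, -13, -25, -36, -45, -55, -65, -77,
    -88, -99, -105, -103, -93, -76, -57, -37, -21, -10, -4, -1]], [[-2, -4, -4, -2, 4, 16, 28, 36,
    40, 36, 26, 16, 8, 2]], [[2, 2, 0, -2, -4, -10, -12, -10, -8, -6, -2]], [[2, 2, 4, 4, 4, 4, 8,
    8, 8, 8, 6, 2]], [[-1, 0, 0, 3, 9, 15, 24, 35, 47, 59, 75, 88, 99, 105, 103, 93, 76, 57, 37,
    21, 10, 4, 1]], [[0, 2, 4, 4, 2, -4, -16, -28, -36, -40, -36, -26, -16, -8, -2]], [], [[-2,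
    -2, 2, 4, 4, 6, 6, 2]]]

/-- A linear form detecting the homology in degree `4`. -/
def formFour : List (List (List ℤ)) :=
    [[[], [], [], [], [], [1, 0, 0, 0, 1], [0, 2], [], [], [2, 0, 0, 0, 2], [2, 0, 0, 2], [], [-1,
    0, 0, 0, -1], [1, 0, 0, 0, 1, -1, 0, 0, 0, -1], [0, 0, 0, 2, 0, 2, 0, 2]]]

/-- A chain exhibiting that the homology in degree `4` is torsion. -/
def chainFour : List (List (List ℤ)) :=
    [[[0, -32]], [[8, 32, 32, 48, 96, 96, 152, 160, 232, 224, 296, 320, 320, 352, 328, 336, 264,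
    256, 184, 144, 96, 64, 32, 16, 8]], [[-16, 0, -64, -48, -128, -144, -256, -256, -352, -400,
    -400, -432, -400, -400, -288, -304, -192, -160, -96, -80, -32, -16, -16]], [[16, 16, 48, 16,
    80, 64, 80, 80, 96, 96, 64, 112, 48, 64, 48, 48, 16, 16, 16]], [[-32, 0, -16, -16, -32, 0,
    -32, -48, 0, -16, -32, -32, 0, -16, -16]], [[16, 16, 32, -16, 16, 16, 16, 0, 16, 16]]]

/-- The composition of `formFour` with the boundary map, divided by the annihilator. -/
def coformFour : List (List (List ℤ)) :=
    [[[2, 2], [], [], [], [-2, -2, -2], [0, 0, -2, -2, -2, -2, -2, -2]]]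

lemma nonempty_matrixHomology_four :
    Nonempty (SeqHomology (boundaryMatrix 4) (matrixCycles 4) ≃ₗ[R] CycQuot 6 × CycQuot 8) := by
  obtain ⟨f⟩ := nonempty_quotient_mul_equiv_prod (isCoprime_cyc (show 6 ≠ 8 by norm_num))
  rw [← ev_eq_cyc_six_mul] at f
  have hz (c) : (evM 15 1 cycleFour).mulVec c ∈ matrixCycles 4 := by
    change (evM 20 15 (boundary 3)).mulVec _ = 0
    rw [Matrix.mulVec_mulVec, ← evM_mulM (by decide +kernel), evM_eq_zero (by decide +kernel),
      Matrix.zero_mulVec]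
  obtain ⟨g⟩ : Nonempty (SeqHomology (boundaryMatrix 4) (matrixCycles 4) ≃ₗ[R] _) :=
    nonempty_equiv_of_isCyclicM (H := homotopy 4) (z := cycleFour) (φ := formFour)
      (y := chainFour) (ψ := coformFour) (u := 8) (p := [1, -1, 1, 0, 1, -1, 1]) (by decide +kernel)
      hz (fun x hx => mulVec_eq_zero_of_vanishesOnKer (Q := cohomotopy 4) (d := [1])
        (by decide +kernel) hx)
  exact ⟨g.trans f⟩

/-- A generator of the homology in degree `5`. -/
def cycleFive : List (List (List ℤ)) :=
    [[[-1, -1, -1]], [[1, 1, 2, 2, 3, 3, 3, 3, 2, 2, 1, 1]], [[-1, -1, -3, -4, -6, -7, -9, -9, -9,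
    -9, -7, -6, -4, -3, -1, -1]], [[1, 1, 2, 2, 3, 3, 3, 3, 2, 2, 1, 1]], [[-1, -1, -1, -1, -1,
    -1, -1, -1]], [[1, 1, 1]]]

/-- A linear form detecting the homology in degree `5`. -/
def formFive : List (List (List ℤ)) :=
    [[[], [], [-1], [], [], [1, -2, -2, 0, -4, -3, -2, -4, -3, -2, -2, -2, 0, -1]]]

lemma nonempty_matrixHomology_five :
    Nonempty (SeqHomology (boundaryMatrix 5) (matrixCycles 5) ≃ₗ[R]
      CycQuot 3 × CycQuot 6 × CycQuot 9 × CycQuot 12) := by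
  have c {m n : ℕ} (h : m ≠ n) : IsCoprime (cyc m) (cyc n) := isCoprime_cyc h
  obtain ⟨f₁⟩ := nonempty_quotient_mul_equiv_prod (c (show 9 ≠ 12 by norm_num))
  obtain ⟨f₂⟩ := nonempty_quotient_mul_equiv_prod
    ((c (show 6 ≠ 9 by norm_num)).mul_right (c (show 6 ≠ 12 by norm_num)))
  obtain ⟨f₃⟩ := nonempty_quotient_mul_equiv_prod
    ((c (show 3 ≠ 6 by norm_num)).mul_right ((c (show 3 ≠ 9 by norm_num)).mul_right
      (c (show 3 ≠ 12 by norm_num))))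
  rw [← ev_eq_cyc_three_mul] at f₃
  have hz (c) : (evM 6 1 cycleFive).mulVec c ∈ matrixCycles 5 := by
    change (evM 15 6 (boundary 4)).mulVec _ = 0
    rw [Matrix.mulVec_mulVec, ← evM_mulM (by decide +kernel), evM_eq_zero (by decide +kernel),
      Matrix.zero_mulVec]
  obtain ⟨g⟩ : Nonempty (SeqHomology (boundaryMatrix 5) (matrixCycles 5) ≃ₗ[R] _) :=
    nonempty_equiv_of_isCyclicM (H := []) (z := cycleFive) (φ := formFive)
      (y := [[[2]]]) (ψ := [[[2]]]) (u := 2) (p := [1, 0, 0, 1, 1, 0, 1, 1, 1, 0, 1, 1, 0, 0, 1])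
      (by decide +kernel)
      hz (fun x hx => mulVec_eq_zero_of_vanishesOnKer (Q := cohomotopy 5)
        (d := [2, -2, 2, 0, 2, -2, 2]) (by decide +kernel) hx)
  exact ⟨g.trans (f₃.trans ((LinearEquiv.refl R _).prodCongr
    (f₂.trans ((LinearEquiv.refl R _).prodCongr f₁))))⟩

lemma subsingleton_matrixHomology_six :
    Subsingleton (SeqHomology (boundaryMatrix 6) (matrixCycles 6)) :=
  subsingleton_of_isExactM (H := []) (Q := [[[1]]]) (u := 1)
    (d := entry (boundary 5) 0 0) (by decide +kernel)

lemma subsingleton_hgy_of_lt {W : Type*} [Group W] {M : CoxeterMatrix (Fin 6)}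
    (cs : CoxeterSystem M W) {k : ℕ} (hk : 6 < k) : Subsingleton (Hgy cs k) := by
  have h : IsEmpty (KW cs k) := ⟨fun σ => by
    have := (Finset.card_le_univ σ.1).trans_eq (Fintype.card_fin 6)
    have := σ.2.1
    omega⟩
  have h' : Subsingleton (cycles cs k) := inferInstance
  exact (Submodule.mkQ_surjective _).subsingleton

end WeightedComplex

open WeightedComplex in
/-- Homology of the weighted complex for the Coxeter system of type `E₆` (generators indexed by `0,…,5` corresponding to `1,…,6`; edges with label 3 are `{1,3},{3,4},{4,5},{5,6},{2,4}`, all other pairs commute). -/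
theorem homology_E6 {W : Type*} [Group W] {Mat : CoxeterMatrix (Fin 6)}
    (cs : CoxeterSystem Mat W)
    (hM : ∀ i j : Fin 6, i.val < j.val →
      Mat.M i j = (if (i.val, j.val) ∈ ([(0, 2), (1, 3), (2, 3), (3, 4), (4, 5)] : List (ℕ × ℕ)) then 3 else 2)) :
    Nonempty (Hgy cs 0 ≃ₗ[R] (CycQuot 2)) ∧
    Subsingleton (Hgy cs 1) ∧
    Subsingleton (Hgy cs 2) ∧
    Subsingleton (Hgy cs 3) ∧
    Nonempty (Hgy cs 4 ≃ₗ[R] (CycQuot 6 × CycQuot 8)) ∧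
    Nonempty (Hgy cs 5 ≃ₗ[R] (CycQuot 3 × CycQuot 6 × CycQuot 9 × CycQuot 12)) ∧
    (∀ k, 6 ≤ k → Subsingleton (Hgy cs k)) := by
  have hM' := coxeterMatrix_eq_mE hM
  have hequiv {k : ℕ} (hk : k < 7) := nonempty_hgy_equiv cs hM' hk
  have hsub {k : ℕ} (hk : k < 7)
      (h : Subsingleton (SeqHomology (boundaryMatrix k) (matrixCycles k))) :
      Subsingleton (Hgy cs k) :=
    (hequiv hk).some.toEquiv.subsingleton
  refine ⟨?_, hsub (by norm_num) subsingleton_matrixHomology_one,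
    hsub (by norm_num) subsingleton_matrixHomology_two,
    hsub (by norm_num) subsingleton_matrixHomology_three, ?_, ?_, fun k hk => ?_⟩
  · exact ⟨(hequiv (by norm_num)).some.trans nonempty_matrixHomology_zero.some⟩
  · exact ⟨(hequiv (by norm_num)).some.trans nonempty_matrixHomology_four.some⟩
  · exact ⟨(hequiv (by norm_num)).some.trans nonempty_matrixHomology_five.some⟩
  · rcases hk.eq_or_lt with rfl | hk
    · exact hsub (by norm_num) subsingleton_matrixHomology_six
    · exact subsingleton_hgy_of_lt cs hk
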